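/- arXiv:2509.13796 — 3 statements merged into one kernel-verified Lean document; each statement's English description precedes it below -/
import Mathlib

section
/- Let p be an odd prime and let K be the unique subfield of ℚ(ζ_{p²}) with [K : ℚ] = p (a totally real cyclic extension of ℚ of degree p). Then for every integer k ≥ 1 one has w_{2k}(K) = ∏_{ℓ} ℓ^{1 + v_ℓ(4pk)}, the product being taken over all primes ℓ such that ℓ − 1 divides 2k; equivalently, w_{2k}(K) = 2^{3 + v_2(k)} · p^{(2 + v_p(k))·δ} · ∏_{ℓ ∉ {2,p}, (ℓ−1) ∣ 2k} ℓ^{1 + v_ℓ(k)}, where δ = 1 if p − 1 divides 2k and δ = 0 otherwise. -/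
open scoped Classical
noncomputable section

open Module

/-- The set of positive integers `m` such that the exponent of `Gal(F(μ_m)/F)` divides `j`. -/
def wSet (F : Type*) [Field F] (j : ℕ) : Set ℕ :=
  {m | 0 < m ∧ ∀ σ : AlgebraicClosure F ≃ₐ[F] AlgebraicClosure F,
      ∀ ζ : AlgebraicClosure F, ζ ^ m = 1 → (σ ^ j) ζ = ζ}

/-- `w_j(F)`, the largest positive integer `m` such that `Gal(F(μ_m)/F)` has exponent
dividing `j`. -/
def w (F : Type*) [Field F] (j : ℕ) : ℕ := sSup (wSet F j)

/-- `ℚ(μ_m)`, the `m`-th cyclotomic field, viewed inside a fixed algebraic closure of `ℚ`. -/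
def cycField (m : ℕ) : IntermediateField ℚ (AlgebraicClosure ℚ) :=
  IntermediateField.adjoin ℚ {ζ : AlgebraicClosure ℚ | ζ ^ m = 1}

set_option linter.unusedSectionVars false

section gen
universe u
variable {Q LL : Type u} [Field Q] [Field LL] [Algebra Q LL] [CharZero Q] [CharZero LL]

lemma wSet_iff [IsAlgClosure Q LL] (K : IntermediateField Q LL) (j m : ℕ) :
    m ∈ wSet K j ↔ 0 < m ∧ ∀ σ : LL ≃ₐ[Q] LL, (∀ x ∈ K, σ x = x) →
      ∀ ζ : LL, ζ ^ m = 1 → (σ ^ j) ζ = ζ := by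
  have : IsAlgClosure K LL := ⟨IsAlgClosure.isAlgClosed Q, by
    have : Algebra.IsAlgebraic Q LL := IsAlgClosure.isAlgebraic
    exact Algebra.IsAlgebraic.tower_top (K := Q) K⟩
  let e : AlgebraicClosure K ≃ₐ[K] LL := IsAlgClosure.equiv K _ _
  unfold wSet
  simp only [Set.mem_ofPred_eq]
  refine and_congr_right fun _ => ⟨fun h σ hσ ζ hζ => ?_, fun h σ ζ hζ => ?_⟩
  · let τ : LL ≃ₐ[K] LL := IntermediateField.fixingSubgroupEquiv K ⟨σ, by simpa using hσ⟩
    have hτ : ∀ n : ℕ, ∀ z, (τ ^ n) z = (σ ^ n) z := by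
      intro n
      induction n with
      | zero => intro z; rfl
      | succ n ih => intro z; rw [pow_succ, pow_succ, AlgEquiv.mul_apply, AlgEquiv.mul_apply, ih]; rfl
    have h1 := h (e.symm.autCongr τ) (e.symm ζ) (by rw [← map_pow, hζ, map_one])
    rw [← map_pow] at h1
    rw [← hτ]
    apply e.symm.injective
    simpa only [AlgEquiv.autCongr_apply, AlgEquiv.trans_apply, AlgEquiv.symm_symm,
      AlgEquiv.apply_symm_apply] using h1
  · let τ := e.autCongr σ
    have hτ : ∀ n : ℕ, ∀ z, (τ ^ n) z = ((τ.restrictScalars Q) ^ n) z := by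
      intro n
      induction n with
      | zero => intro z; rfl
      | succ n ih => intro z; rw [pow_succ, pow_succ, AlgEquiv.mul_apply, AlgEquiv.mul_apply, ih]; rfl
    have h1 := h (τ.restrictScalars Q) (fun x hx => τ.commutes ⟨x, hx⟩) (e ζ)
      (by rw [← map_pow, hζ, map_one])
    rw [← hτ, ← map_pow] at h1
    apply e.injective
    simpa only [AlgEquiv.autCongr_apply, AlgEquiv.trans_apply, AlgEquiv.symm_symm,
      AlgEquiv.symm_apply_apply] using h1

lemma exists_prim [IsAlgClosed LL] (n : ℕ) (hn : 0 < n) : ∃ ζ : LL, IsPrimitiveRoot ζ n := by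
  have : NeZero (n : LL) := ⟨by exact_mod_cast hn.ne'⟩
  exact HasEnoughRootsOfUnity.exists_primitiveRoot LL n

lemma gal_pow [IsAlgClosed LL] (n : ℕ) (hn : 0 < n) (σ : LL ≃ₐ[Q] LL) : ∃ x : ℕ, x.Coprime n ∧
    ∀ ζ : LL, ζ ^ n = 1 → σ ζ = ζ ^ x := by
  obtain ⟨ξ, hξ⟩ := exists_prim (LL := LL) n hn
  have : NeZero n := ⟨hn.ne'⟩
  obtain ⟨x, hx, hx'⟩ := hξ.eq_pow_of_pow_eq_one (ξ := σ ξ) (by rw [← map_pow, hξ.pow_eq_one, map_one])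
  refine ⟨x, ?_, fun ζ hζ => ?_⟩
  · rw [← hξ.pow_iff_coprime hn, hx']
    exact hξ.map_of_injective σ.injective
  · obtain ⟨i, _, rfl⟩ := hξ.eq_pow_of_pow_eq_one hζ
    rw [map_pow, ← hx', ← pow_mul, ← pow_mul, mul_comm]

lemma gal_pow_pow {n : ℕ} {σ : LL ≃ₐ[Q] LL} {x : ℕ} 
    (h : ∀ ζ : LL, ζ ^ n = 1 → σ ζ = ζ ^ x) (j : ℕ) (ζ : LL) (hζ : ζ ^ n = 1) :
    (σ ^ j) ζ = ζ ^ (x ^ j) := by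
  induction j with
  | zero => simp
  | succ j ih => rw [pow_succ', AlgEquiv.mul_apply, ih, map_pow, h _ hζ, ← pow_mul, pow_succ']

lemma pow_eq_self_iff {n : ℕ} {ξ : LL} (hn : 0 < n) (hξ : IsPrimitiveRoot ξ n) (y : ℕ) :
    ξ ^ y = ξ ↔ y ≡ 1 [MOD n] := by
  have hξ' := hξ.isUnit_unit hn.ne'
  rw [hξ'.eq_orderOf, ← pow_eq_pow_iff_modEq, Units.ext_iff]
  simp

lemma pow_eq_self {n : ℕ} {ζ : LL} (hζ : ζ ^ n = 1) {y : ℕ} (h : y ≡ 1 [MOD n]) : ζ ^ y = ζ := by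
  conv_rhs => rw [← pow_one ζ]
  have h2 : y ≡ 1 [MOD orderOf ζ] := h.of_dvd (orderOf_dvd_of_pow_eq_one hζ)
  rw [← pow_mod_orderOf, h2, pow_mod_orderOf]

lemma gal_surj [IsAlgClosure Q LL]
    (hirr : ∀ n, 0 < n → Irreducible (Polynomial.cyclotomic n Q)) (n : ℕ) (hn : 0 < n) (x : ℕ) (hx : x.Coprime n) : ∃ σ : LL ≃ₐ[Q] LL,
    ∀ ζ : LL, ζ ^ n = 1 → σ ζ = ζ ^ x := by
  have : IsAlgClosed LL := IsAlgClosure.isAlgClosed Q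
  have : Algebra.IsAlgebraic Q LL := IsAlgClosure.isAlgebraic
  have : Normal Q LL := IsAlgClosure.normal _ _
  obtain ⟨ξ, hξ⟩ := exists_prim (LL := LL) n hn
  have : NeZero n := ⟨hn.ne'⟩
  have h2 : IsPrimitiveRoot (ξ ^ x) n := hξ.pow_of_coprime x hx
  have : IsConjRoot Q (ξ ^ x) ξ := by
    unfold IsConjRoot
    rw [← hξ.minpoly_eq_cyclotomic_of_irreducible (hirr n hn), ← h2.minpoly_eq_cyclotomic_of_irreducible (hirr n hn)]
  obtain ⟨σ, hσ⟩ := isConjRoot_iff_exists_algEquiv.mp this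
  refine ⟨σ, fun ζ hζ => ?_⟩
  obtain ⟨i, _, rfl⟩ := hξ.eq_pow_of_pow_eq_one hζ
  rw [map_pow, hσ, ← pow_mul, ← pow_mul, mul_comm]

lemma fix_cyc {n : ℕ} {σ : LL ≃ₐ[Q] LL} (h : ∀ ζ : LL, ζ ^ n = 1 → σ ζ = ζ) :
    ∀ x ∈ IntermediateField.adjoin Q {ζ : LL | ζ ^ n = 1}, σ x = x := by
  have : IntermediateField.adjoin Q {ζ : LL | ζ ^ n = 1} ≤ IntermediateField.fixedField (Subgroup.zpowers σ) := by
    rw [IntermediateField.adjoin_le_iff]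
    intro ζ hζ
    rw [SetLike.mem_coe, IntermediateField.mem_fixedField_iff]
    intro f hf
    have : Subgroup.zpowers σ ≤ MulAction.stabilizer (LL ≃ₐ[Q] LL) ζ := by
      rw [Subgroup.zpowers_le]
      exact h ζ hζ
    exact this hf
  intro x hx
  exact (IntermediateField.mem_fixedField_iff _ _).1 (this hx) σ (Subgroup.mem_zpowers σ)

lemma cycField_cyc [IsAlgClosed LL] [Algebra.IsAlgebraic Q LL] (n : ℕ) (hn : 0 < n) : IsCyclotomicExtension {n} Q (IntermediateField.adjoin Q {ζ : LL | ζ ^ n = 1}) := by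
  have := IntermediateField.isCyclotomicExtension_adjoin_of_exists_isPrimitiveRoot {n} Q LL
    (by intro m hm _; exact exists_prim _ (by simp at hm; omega))
  have e : {b : LL | ∃ m ∈ ({n} : Set ℕ), m ≠ 0 ∧ b ^ m = 1} = {b | b ^ n = 1} := by
    ext b; simp [hn.ne']
  rw [e] at this
  exact this

lemma pow_p_fix [IsAlgClosure Q LL]
    (n : ℕ) (hn : 0 < n) (K : IntermediateField Q LL) (hsub : K ≤ IntermediateField.adjoin Q {ζ : LL | ζ ^ n = 1})
    (σ : LL ≃ₐ[Q] LL) : ∀ x ∈ K, (σ ^ (finrank Q K)) x = x := by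
  have : IsAlgClosed LL := IsAlgClosure.isAlgClosed Q
  have : Algebra.IsAlgebraic Q LL := IsAlgClosure.isAlgebraic
  have : Normal Q LL := IsAlgClosure.normal _ _
  have := cycField_cyc (Q := Q) (LL := LL) n hn
  have : IsAbelianGalois Q (IntermediateField.adjoin Q {ζ : LL | ζ ^ n = 1}) := IsCyclotomicExtension.isAbelianGalois {n} Q _
  have : FiniteDimensional Q (IntermediateField.adjoin Q {ζ : LL | ζ ^ n = 1}) := IsCyclotomicExtension.finiteDimensional {n} Q _
  have : IsAbelianGalois Q K := IsAbelianGalois.of_algHom (IntermediateField.inclusion hsub)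
  have : FiniteDimensional Q K := FiniteDimensional.of_injective (IntermediateField.inclusion hsub).toLinearMap
    (IntermediateField.inclusion hsub).injective
  intro x hx
  have h := AlgEquiv.restrictNormalHom_apply K (σ ^ (finrank Q K)) ⟨x, hx⟩
  rw [← h, map_pow, ← IsGalois.card_aut_eq_finrank, pow_card_eq_one']
  rfl

lemma pow_q_fix [IsAlgClosure Q LL]
    (hirr : ∀ n, 0 < n → Irreducible (Polynomial.cyclotomic n Q)) (n : ℕ) (hn : 0 < n) (K : IntermediateField Q LL) (hsub : K ≤ IntermediateField.adjoin Q {ζ : LL | ζ ^ n = 1})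
    (d : ℕ) (hd : finrank Q K * d = n.totient)
    (σ : LL ≃ₐ[Q] LL) (hσ : ∀ x ∈ K, σ x = x) (ζ : LL) (hζ : ζ ^ n = 1) : (σ ^ d) ζ = ζ := by
  have : IsAlgClosed LL := IsAlgClosure.isAlgClosed Q
  have : Algebra.IsAlgebraic Q LL := IsAlgClosure.isAlgebraic
  have : Normal Q LL := IsAlgClosure.normal _ _
  have := cycField_cyc (Q := Q) (LL := LL) n hn
  have : NeZero n := ⟨hn.ne'⟩
  have : IsAbelianGalois Q (IntermediateField.adjoin Q {ζ : LL | ζ ^ n = 1}) := IsCyclotomicExtension.isAbelianGalois {n} Q _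
  have : FiniteDimensional Q (IntermediateField.adjoin Q {ζ : LL | ζ ^ n = 1}) := IsCyclotomicExtension.finiteDimensional {n} Q _
  let K' := IntermediateField.restrict hsub
  have h1 : finrank Q K' = finrank Q K :=
    (IntermediateField.restrictAlgEquiv hsub).symm.toLinearEquiv.finrank_eq
  have h2 : finrank Q (IntermediateField.adjoin Q {ζ : LL | ζ ^ n = 1}) = n.totient :=
    IsCyclotomicExtension.finrank (n := n) _ (hirr n hn)
  have h3 := Module.finrank_mul_finrank Q K' (IntermediateField.adjoin Q {ζ : LL | ζ ^ n = 1})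
  have hd' : finrank K' (IntermediateField.adjoin Q {ζ : LL | ζ ^ n = 1}) = d := by
    have hpos : 0 < finrank Q K' := Module.finrank_pos
    rw [h2, ← hd, h1] at h3
    rw [h1] at hpos
    exact Nat.eq_of_mul_eq_mul_left hpos h3
  have h4 := IsGalois.card_fixingSubgroup_eq_finrank K'
  let τ := AlgEquiv.restrictNormalHom (IntermediateField.adjoin Q {ζ : LL | ζ ^ n = 1}) σ
  have hτ : τ ∈ K'.fixingSubgroup := by
    rw [IntermediateField.mem_fixingSubgroup_iff]
    intro x hx
    apply Subtype.ext
    rw [AlgEquiv.restrictNormalHom_apply]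
    exact hσ _ ((IntermediateField.mem_restrict hsub x).1 hx)
  have h5 : τ ^ d = 1 := by
    have := pow_card_eq_one' (x := (⟨τ, hτ⟩ : K'.fixingSubgroup))
    rw [h4, hd'] at this
    exact congrArg Subtype.val this
  have h := AlgEquiv.restrictNormalHom_apply (IntermediateField.adjoin Q {ζ : LL | ζ ^ n = 1}) (σ ^ d)
    ⟨ζ, IntermediateField.subset_adjoin _ _ hζ⟩
  rw [← h, map_pow, h5]
  rfl

end gen

lemma lift_one {ℓ s y : ℕ} (hs : 1 ≤ s) (h : y ≡ 1 [MOD ℓ ^ s]) (b : ℕ) :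
    y ^ (ℓ ^ b) ≡ 1 [MOD ℓ ^ (s + b)] := by
  have key : ∀ b : ℕ, ((ℓ : ℤ) ^ (s + b)) ∣ (y : ℤ) ^ (ℓ ^ b) - 1 := by
    intro b
    induction b with
    | zero =>
      have := (Nat.modEq_iff_dvd.1 h.symm)
      push_cast at this
      simpa using this
    | succ b ih =>
      have h1 : (ℓ : ℤ) ∣ (y : ℤ) ^ (ℓ ^ b) - 1 :=
        (dvd_pow_self _ (by omega)).trans ih
      have h2 := dvd_geom_sum₂_self h1
      have h3 := (Commute.all ((y : ℤ) ^ (ℓ ^ b)) 1).mul_geom_sum₂ ℓ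
      rw [pow_succ, pow_mul, ← add_assoc, pow_succ]
      rw [one_pow] at h3
      rw [← h3]
      exact mul_dvd_mul ih h2
  apply Nat.ModEq.symm
  rw [Nat.modEq_iff_dvd]
  push_cast
  exact key b

lemma lift_gen {ℓ s x d b n a : ℕ} (hs : 1 ≤ s) (h : x ^ d ≡ 1 [MOD ℓ ^ s])
    (hn : d * ℓ ^ b ∣ n) (ha : a ≤ s + b) : x ^ n ≡ 1 [MOD ℓ ^ a] := by
  obtain ⟨c, rfl⟩ := hn
  have h1 := ((lift_one hs h b).pow c).of_dvd (pow_dvd_pow ℓ ha)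
  rwa [one_pow, ← pow_mul, ← pow_mul, ← mul_assoc] at h1

lemma exp_odd {ℓ a n : ℕ} (hℓ : ℓ.Prime) (h2 : ℓ ≠ 2) (ha : 1 ≤ a) (hn : n ≠ 0)
    (h : ∀ x : ℕ, x.Coprime (ℓ ^ a) → x ^ n ≡ 1 [MOD ℓ ^ a]) :
    ℓ - 1 ∣ n ∧ a ≤ 1 + padicValNat ℓ n := by
  have := Fact.mk hℓ
  have : NeZero (ℓ ^ a) := ⟨(pow_pos hℓ.pos a).ne'⟩
  have hc := ZMod.isCyclic_units_of_prime_pow ℓ hℓ h2 a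
  have h1 : Monoid.exponent (ZMod (ℓ ^ a))ˣ ∣ n := by
    apply Monoid.exponent_dvd_of_forall_pow_eq_one
    intro u
    have := h (u : ZMod (ℓ ^ a)).val (ZMod.val_coe_unit_coprime u)
    rw [← ZMod.natCast_eq_natCast_iff] at this
    ext
    push_cast at this ⊢
    simpa using this
  rw [IsCyclic.exponent_eq_card, Nat.card_eq_fintype_card, ZMod.card_units_eq_totient,
    Nat.totient_prime_pow hℓ ha] at h1
  refine ⟨(dvd_mul_left _ _).trans h1, ?_⟩
  have := (padicValNat_dvd_iff_le hn).1 ((dvd_mul_right _ _).trans h1)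
  omega

lemma exp_two {a k : ℕ} (hk : k ≠ 0) (h : 3 ^ (2 * k) ≡ 1 [MOD 2 ^ a]) :
    a ≤ 3 + padicValNat 2 k := by
  have h1 := padicValNat.pow_two_sub_pow (x := 3) (y := 1) (by norm_num) (by norm_num) (by norm_num) (n := 2 * k) (by omega) (by simp)
  have h0 : 3 ^ (2 * k) - 1 ≠ 0 := by
    have : 3 ^ 1 ≤ 3 ^ (2 * k) := Nat.pow_le_pow_right (by norm_num) (by omega)
    omega
  have h2 : 2 ^ a ∣ 3 ^ (2 * k) - 1 := (Nat.modEq_iff_dvd' (by omega)).1 h.symm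
  have h3 := (padicValNat_dvd_iff_le h0).1 h2
  have e4 : padicValNat 2 4 = 2 := by
    rw [show (4 : ℕ) = 2 ^ 2 by norm_num]; exact padicValNat.prime_pow 2
  have e2 : padicValNat 2 2 = 1 := padicValNat.self (by norm_num)
  have e2k : padicValNat 2 (2 * k) = 1 + padicValNat 2 k := by
    rw [padicValNat.mul (by norm_num) hk, e2]
  rw [one_pow] at h1
  norm_num [e4, e2, e2k] at h1
  omega

lemma val_eq {ℓ p k : ℕ} (hℓ : ℓ.Prime) (hp : p.Prime) (hk : k ≠ 0) :
    padicValNat ℓ (4 * p * k) = (if ℓ = 2 then 2 else 0) + (if ℓ = p then 1 else 0)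
      + padicValNat ℓ k := by
  have := Fact.mk hℓ
  have := Fact.mk hp
  rw [padicValNat.mul (by simp [hp.ne_zero]) hk, padicValNat.mul (by norm_num) hp.ne_zero]
  congr 2
  · rw [show (4 : ℕ) = 2 * 2 by norm_num, padicValNat.mul (by norm_num) (by norm_num)]
    split_ifs with h
    · subst h; rw [padicValNat.self (by norm_num)]
    · rw [padicValNat_primes h]
  · split_ifs with h
    · subst h; exact padicValNat.self hℓ.one_lt
    · exact padicValNat_primes h

section gen2
universe u
variable {Q LL : Type u} [Field Q] [Field LL] [Algebra Q LL] [CharZero Q] [CharZero LL]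

lemma pp_iff [IsAlgClosure Q LL]
    (hirr : ∀ n, 0 < n → Irreducible (Polynomial.cyclotomic n Q))
    (p : ℕ) (hp : p.Prime) (hodd : p ≠ 2) (K : IntermediateField Q LL)
    (hsub : K ≤ IntermediateField.adjoin Q {ζ : LL | ζ ^ (p ^ 2) = 1})
    (hdeg : finrank Q K = p) (k : ℕ) (hk : 1 ≤ k) (ℓ : ℕ) (hℓ : ℓ.Prime) (a : ℕ) (ha : 1 ≤ a) :
    ℓ ^ a ∈ wSet K (2 * k) ↔ (ℓ - 1 ∣ 2 * k ∧ a ≤ 1 + padicValNat ℓ (4 * p * k)) := by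
  have : IsAlgClosed LL := IsAlgClosure.isAlgClosed Q
  have hk0 : k ≠ 0 := by omega
  have h2k : 2 * k ≠ 0 := by omega
  have hla : 0 < ℓ ^ a := pow_pos hℓ.pos a
  have hp2 : 0 < p ^ 2 := pow_pos hp.pos 2
  have := Fact.mk hℓ
  have hvk : ℓ ^ padicValNat ℓ k ∣ k := pow_padicValNat_dvd
  rw [wSet_iff, val_eq hℓ hp hk0]
  obtain ⟨ξ, hξ⟩ := exists_prim (LL := LL) (ℓ ^ a) hla
  constructor
  · rintro ⟨-, h⟩
    by_cases hlp : ℓ = p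
    · subst hlp
      have h1 : ∀ x : ℕ, x.Coprime (ℓ ^ a) → x ^ (ℓ * (2 * k)) ≡ 1 [MOD ℓ ^ a] := by
        intro x hx
        obtain ⟨σ, hσ⟩ := gal_surj (LL := LL) hirr (ℓ ^ a) hla x hx
        have h3 := h (σ ^ ℓ) (by rw [← hdeg]; exact pow_p_fix _ hp2 K hsub σ) ξ hξ.pow_eq_one
        rw [← pow_mul, gal_pow_pow hσ _ ξ hξ.pow_eq_one, pow_eq_self_iff hla hξ] at h3
        exact h3
      obtain ⟨h2, h3⟩ := exp_odd hℓ hodd ha (mul_ne_zero hℓ.ne_zero h2k) h1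
      refine ⟨?_, ?_⟩
      · refine Nat.Coprime.dvd_of_dvd_mul_left ?_ h2
        have := (Nat.coprime_self_sub_right hℓ.one_le).2 (Nat.coprime_one_right ℓ)
        exact this.symm
      · rw [padicValNat.mul hℓ.ne_zero h2k, padicValNat.mul (by norm_num) hk0,
          padicValNat.self hℓ.one_lt, padicValNat_primes (q := 2) hodd] at h3
        simp [hodd]; omega
    · have hcop : Nat.Coprime (ℓ ^ a) (p ^ 2) :=
        Nat.Coprime.pow _ _ ((Nat.coprime_primes hℓ hp).2 hlp)
      have h1 : ∀ x : ℕ, x.Coprime (ℓ ^ a) → x ^ (2 * k) ≡ 1 [MOD ℓ ^ a] := by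
        intro x hx
        obtain ⟨y, hy1, hy2⟩ := Nat.chineseRemainder hcop x 1
        have hyc : y.Coprime (ℓ ^ a * p ^ 2) := by
          apply Nat.Coprime.mul_right
          · unfold Nat.Coprime; rw [hy1.gcd_eq]; exact hx
          · unfold Nat.Coprime; rw [hy2.gcd_eq]; simp
        obtain ⟨σ, hσ⟩ := gal_surj (LL := LL) hirr (ℓ ^ a * p ^ 2) (by positivity) y hyc
        have hfix : ∀ z ∈ K, σ z = z := fun z hz => fix_cyc (n := p ^ 2) (σ := σ) (by
          intro ζ hζ
          rw [hσ ζ (by rw [mul_comm, pow_mul, hζ, one_pow])]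
          exact pow_eq_self hζ hy2) z (hsub hz)
        have hσ' : ∀ ζ : LL, ζ ^ (ℓ ^ a) = 1 → σ ζ = ζ ^ y := fun ζ hζ =>
          hσ ζ (by rw [pow_mul, hζ, one_pow])
        have h3 := h σ hfix ξ hξ.pow_eq_one
        rw [gal_pow_pow hσ' _ ξ hξ.pow_eq_one, pow_eq_self_iff hla hξ] at h3
        exact (hy1.symm.pow _).trans h3
      by_cases hl2 : ℓ = 2
      · subst hl2
        refine ⟨by simp, ?_⟩
        have := exp_two hk0 (h1 3 (Nat.Coprime.pow_right _ (by norm_num)))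
        simp [hlp]; omega
      · obtain ⟨h2, h3⟩ := exp_odd hℓ hl2 ha h2k h1
        refine ⟨h2, ?_⟩
        rw [padicValNat.mul (by norm_num) hk0, padicValNat_primes (q := 2) hl2] at h3
        simp [hlp, hl2]; omega
  · rintro ⟨hd, hle⟩
    refine ⟨hla, fun σ hσ ζ hζ => ?_⟩
    have hcop1 : Nat.Coprime (ℓ - 1) ℓ :=
      ((Nat.coprime_self_sub_right hℓ.one_le).2 (Nat.coprime_one_right ℓ)).symm
    have hdvd : (ℓ - 1) * ℓ ^ padicValNat ℓ k ∣ 2 * k :=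
      (hcop1.pow_right _).mul_dvd_of_dvd_of_dvd hd (hvk.mul_left 2)
    obtain ⟨x, hx, hx'⟩ := gal_pow (ℓ ^ (a + 2)) (pow_pos hℓ.pos _) σ
    have hxl : x.Coprime ℓ := hx.coprime_dvd_right (dvd_pow_self _ (by omega))
    have hxa : ∀ ζ : LL, ζ ^ (ℓ ^ a) = 1 → σ ζ = ζ ^ x := fun ζ hζ =>
      hx' ζ (by rw [pow_add, pow_mul, hζ, one_pow])
    rw [gal_pow_pow hxa _ ζ hζ]
    apply pow_eq_self hζ
    by_cases hlp : ℓ = p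
    · subst hlp
      obtain ⟨η, hη⟩ := exists_prim (LL := LL) (ℓ ^ 2) hp2
      have hx2 : ∀ ζ : LL, ζ ^ (ℓ ^ 2) = 1 → σ ζ = ζ ^ x := fun ζ hζ =>
        hx' ζ (by rw [pow_add, mul_comm, pow_mul, hζ, one_pow])
      have h1 := pow_q_fix hirr (ℓ ^ 2) hp2 K hsub (ℓ - 1) (by
        rw [hdeg, Nat.totient_prime_pow hℓ (by norm_num)]; simp) σ hσ η hη.pow_eq_one
      rw [gal_pow_pow hx2 _ η hη.pow_eq_one, pow_eq_self_iff hp2 hη] at h1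
      refine lift_gen (s := 2) (by norm_num) h1 hdvd ?_
      simp [hodd] at hle; omega
    · by_cases hl2 : ℓ = 2
      · subst hl2
        have h8 : x ^ 2 ≡ 1 [MOD 2 ^ 3] := by
          have : Odd x := by rwa [Nat.coprime_two_right] at hxl
          have h4 : x % 8 = 1 ∨ x % 8 = 3 ∨ x % 8 = 5 ∨ x % 8 = 7 := by
            obtain ⟨c, rfl⟩ := this; omega
          unfold Nat.ModEq
          rcases h4 with h4 | h4 | h4 | h4 <;> norm_num [Nat.pow_mod, h4]
        refine lift_gen (s := 3) (by norm_num) h8 (Nat.mul_dvd_mul_left 2 hvk) ?_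
        simp [hlp] at hle; omega
      · refine lift_gen (s := 1) le_rfl (d := ℓ - 1) ?_ hdvd ?_
        · rw [pow_one, ← Nat.totient_prime hℓ]; exact Nat.ModEq.pow_totient hxl
        · simp [hlp, hl2] at hle; omega

lemma wSet_mul (K : IntermediateField Q LL) [IsAlgClosure Q LL] (j a b : ℕ) (hab : a.Coprime b)
    (ha : a ∈ wSet K j) (hb : b ∈ wSet K j) : a * b ∈ wSet K j := by
  rw [wSet_iff] at *
  refine ⟨Nat.mul_pos ha.1 hb.1, fun σ hσ ζ hζ => ?_⟩
  have h0 : ζ ≠ 0 := by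
    rintro rfl
    rw [zero_pow (Nat.mul_pos ha.1 hb.1).ne'] at hζ
    exact zero_ne_one hζ
  have h1 := ha.2 σ hσ (ζ ^ b) (by rw [← pow_mul, mul_comm b, hζ])
  have h2 := hb.2 σ hσ (ζ ^ a) (by rw [← pow_mul, hζ])
  have h3 : ζ = (ζ ^ a) ^ (a.gcdA b) * (ζ ^ b) ^ (a.gcdB b) := by
    rw [← zpow_natCast, ← zpow_natCast, ← zpow_mul, ← zpow_mul, ← zpow_add₀ h0,
      ← Nat.gcd_eq_gcd_ab, hab]
    simp
  conv_lhs => rw [h3]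
  rw [map_mul, map_zpow₀, map_zpow₀, h1, h2, ← h3]

lemma wSet_dvd (K : IntermediateField Q LL) [IsAlgClosure Q LL] (j a b : ℕ) (hab : a ∣ b)
    (hb : b ∈ wSet K j) : a ∈ wSet K j := by
  rw [wSet_iff] at *
  refine ⟨Nat.pos_of_dvd_of_pos hab hb.1, fun σ hσ ζ hζ => hb.2 σ hσ ζ ?_⟩
  obtain ⟨c, rfl⟩ := hab
  rw [pow_mul, hζ, one_pow]

lemma wSet_of_pp (K : IntermediateField Q LL) [IsAlgClosure Q LL] (j m : ℕ) (hm : m ≠ 0)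
    (h : ∀ ℓ a : ℕ, ℓ.Prime → 1 ≤ a → ℓ ^ a ∣ m → ℓ ^ a ∈ wSet K j) : m ∈ wSet K j := by
  induction m using Nat.recOnPosPrimePosCoprime with
  | zero => exact absurd rfl hm
  | one => rw [wSet_iff]; refine ⟨one_pos, fun σ _ ζ hζ => ?_⟩; rw [pow_one] at hζ; rw [hζ, map_one]
  | prime_pow p n hp hn => exact h p n hp hn dvd_rfl
  | coprime a b ha hb hab iha ihb =>
    exact wSet_mul K j a b hab
      (iha (by omega) fun ℓ c h1 h2 h3 => h ℓ c h1 h2 (h3.mul_right _))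
      (ihb (by omega) fun ℓ c h1 h2 h3 => h ℓ c h1 h2 (h3.mul_left _))

end gen2

lemma w_eq_prod {A : Set ℕ} {S : Finset ℕ} {e : ℕ → ℕ} (hS : ∀ ℓ ∈ S, ℓ.Prime)
    (hpp : ∀ ℓ a : ℕ, ℓ.Prime → 1 ≤ a → (ℓ ^ a ∈ A ↔ ℓ ∈ S ∧ a ≤ e ℓ))
    (hdvd : ∀ a b, a ∣ b → b ∈ A → a ∈ A)
    (hof : ∀ m, m ≠ 0 → (∀ ℓ a : ℕ, ℓ.Prime → 1 ≤ a → ℓ ^ a ∣ m → ℓ ^ a ∈ A) → m ∈ A) :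
    sSup A = ∏ ℓ ∈ S, ℓ ^ e ℓ := by
  have hN : ∏ ℓ ∈ S, ℓ ^ e ℓ ≠ 0 :=
    Finset.prod_ne_zero_iff.2 fun ℓ hℓ => pow_ne_zero _ (hS ℓ hℓ).ne_zero
  apply IsGreatest.csSup_eq
  constructor
  · apply hof _ hN
    intro ℓ a hℓ ha hd
    rw [hpp ℓ a hℓ ha]
    have h1 : ℓ ∣ ∏ ℓ ∈ S, ℓ ^ e ℓ := (dvd_pow_self ℓ (by omega)).trans hd
    obtain ⟨r, hr, hr'⟩ := (hℓ.prime.dvd_finsetProd_iff _).1 h1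
    have : ℓ = r := (Nat.prime_dvd_prime_iff_eq hℓ (hS r hr)).1 (hℓ.dvd_of_dvd_pow hr')
    subst this
    refine ⟨hr, ?_⟩
    rw [← Finset.mul_prod_erase S _ hr] at hd
    have hc : Nat.Coprime (ℓ ^ a) (∏ x ∈ S.erase ℓ, x ^ e x) := by
      apply Nat.Coprime.prod_right
      intro i hi
      rw [Finset.mem_erase] at hi
      exact Nat.Coprime.pow _ _ ((Nat.coprime_primes hℓ (hS i hi.2)).2 hi.1.symm)
    exact (Nat.pow_dvd_pow_iff_le_right hℓ.one_lt).1 (hc.dvd_of_dvd_mul_right hd)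
  · intro m hm
    apply Nat.le_of_dvd (Nat.pos_of_ne_zero hN)
    rw [Nat.dvd_iff_prime_pow_dvd_dvd]
    intro ℓ a hℓ hd
    rcases Nat.eq_zero_or_pos a with rfl | ha
    · simp
    obtain ⟨h1, h2⟩ := (hpp ℓ a hℓ ha).1 (hdvd _ _ hd hm)
    exact (pow_dvd_pow ℓ h2).trans (Finset.dvd_prod_of_mem (fun ℓ => ℓ ^ e ℓ) h1)

lemma prod_second (p : ℕ) (hp : p.Prime) (hodd : p ≠ 2) (k : ℕ) (hk : 1 ≤ k) (S : Finset ℕ)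
    (hS : ∀ ℓ, ℓ ∈ S ↔ ℓ.Prime ∧ (ℓ - 1) ∣ 2 * k) :
    ∏ ℓ ∈ S, ℓ ^ (1 + padicValNat ℓ (4 * p * k)) = 2 ^ (3 + padicValNat 2 k) *
        p ^ ((2 + padicValNat p k) * (if (p - 1) ∣ 2 * k then 1 else 0)) *
        ∏ᶠ (ℓ : ℕ) (_ : ℓ.Prime ∧ ℓ ≠ 2 ∧ ℓ ≠ p ∧ (ℓ - 1) ∣ 2 * k),
          ℓ ^ (1 + padicValNat ℓ k) := by
  have hk0 : k ≠ 0 := by omega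
  have h2 : 2 ∈ S := (hS 2).2 ⟨Nat.prime_two, by simp⟩
  rw [finprod_cond_eq_prod_of_cond_iff (t := (S.erase 2).erase p) _ (by
    intro x _; simp only [Finset.mem_erase, hS]; tauto)]
  rw [← Finset.mul_prod_erase S _ h2, mul_assoc (2 ^ _)]
  have e2 : 1 + padicValNat 2 (4 * p * k) = 3 + padicValNat 2 k := by
    rw [val_eq Nat.prime_two hp hk0]; simp [hodd.symm]; omega
  rw [e2]
  congr 1
  have hrest : ∏ x ∈ (S.erase 2).erase p, x ^ (1 + padicValNat x (4 * p * k)) =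
      ∏ x ∈ (S.erase 2).erase p, x ^ (1 + padicValNat x k) := by
    apply Finset.prod_congr rfl
    intro x hx
    simp only [Finset.mem_erase, hS] at hx
    rw [val_eq hx.2.2.1 hp hk0]; simp [hx.1, hx.2.1]
  rw [← hrest]
  split_ifs with hd
  · have hpS : p ∈ S.erase 2 := Finset.mem_erase.2 ⟨hodd, (hS p).2 ⟨hp, hd⟩⟩
    rw [← Finset.mul_prod_erase _ _ hpS]
    congr 2
    rw [val_eq hp hp hk0]; simp [hodd]; omega
  · rw [Finset.erase_eq_of_notMem (a := p)]
    · simp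
    · simp [hS, hd]

instance isAlgClosureLL : IsAlgClosure ℚ (AlgebraicClosure ℚ) := by
  have h : @Algebra.IsAlgebraic ℚ (AlgebraicClosure ℚ) _ _ (AlgebraicClosure.instAlgebra ℚ) :=
    AlgebraicClosure.isAlgebraic ℚ
  refine ⟨inferInstance, ?_⟩
  convert h
  exact Subsingleton.elim _ _

theorem w_of_degree_p_subfield_of_cyclotomic_p_sq
    (p : ℕ) (hp : p.Prime) (hodd : p ≠ 2)
    (K : IntermediateField ℚ (AlgebraicClosure ℚ))
    (hsub : K ≤ cycField (p ^ 2))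
    (hdeg : finrank ℚ ↥K = p)
    (k : ℕ) (hk : 1 ≤ k) :
    (w ↥K (2 * k) = ∏ᶠ (ℓ : ℕ) (_ : ℓ.Prime ∧ (ℓ - 1) ∣ 2 * k),
        ℓ ^ (1 + padicValNat ℓ (4 * p * k))) ∧
    (w ↥K (2 * k) = 2 ^ (3 + padicValNat 2 k) *
        p ^ ((2 + padicValNat p k) * (if (p - 1) ∣ 2 * k then 1 else 0)) *
        ∏ᶠ (ℓ : ℕ) (_ : ℓ.Prime ∧ ℓ ≠ 2 ∧ ℓ ≠ p ∧ (ℓ - 1) ∣ 2 * k),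
          ℓ ^ (1 + padicValNat ℓ k)) := by
  have hdeg' : @finrank ℚ K _ _ (IntermediateField.module' K) = p := by
    rw [← hdeg]
  have hirr : ∀ n, 0 < n → Irreducible (Polynomial.cyclotomic n ℚ) :=
    fun n hn => Polynomial.cyclotomic.irreducible_rat hn
  let S := (Finset.range (2 * k + 2)).filter fun ℓ => ℓ.Prime ∧ (ℓ - 1) ∣ 2 * k
  have hS : ∀ ℓ, ℓ ∈ S ↔ ℓ.Prime ∧ (ℓ - 1) ∣ 2 * k := by
    intro ℓ
    simp only [S, Finset.mem_filter, Finset.mem_range, and_iff_right_iff_imp]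
    rintro ⟨_, h⟩
    have := Nat.le_of_dvd (by omega) h
    omega
  have main : w ↥K (2 * k) = ∏ ℓ ∈ S, ℓ ^ (1 + padicValNat ℓ (4 * p * k)) := by
    unfold w
    apply w_eq_prod (fun ℓ hℓ => ((hS ℓ).1 hℓ).1)
    · intro ℓ a hℓ ha
      rw [hS]
      simp only [hℓ, true_and]
      exact pp_iff hirr p hp hodd K hsub hdeg' k hk ℓ hℓ a ha
    · exact fun a b => wSet_dvd K _ a b
    · exact fun m hm h => wSet_of_pp K _ m hm h
  refine ⟨?_, ?_⟩
  · rw [main, finprod_cond_eq_prod_of_cond_iff (t := S) _ (fun {x} _ => (hS x).symm)]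
  · rw [main, prod_second p hp hodd k hk S hS]
end
end

section
/- Let p be a prime and q an odd prime, and let K be a totally real subfield of ℚ(ζ_q) with [K : ℚ] = p (so K is cyclic of degree p over ℚ and p divides (q − 1)/2). Then for every integer k ≥ 1 one has w_{2k}(K) = 2^{3 + v_2(k)} · q^{(1 + v_q(k))·ε} · ∏_{ℓ ∉ {2,q}, (ℓ−1) ∣ 2k} ℓ^{1 + v_ℓ(k)}, where the product is over primes ℓ different from 2 and q with ℓ − 1 dividing 2k, and ε = 1 if (q − 1)/p divides 2k and ε = 0 otherwise. -/
open scoped Classical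
noncomputable section

open Module

/-- A field is totally real if every complex embedding takes values in `ℝ`. -/
def IsTotallyReal (F : Type*) [Field F] : Prop :=
  ∀ φ : F →+* ℂ, ∀ x : F, (φ x).im = 0

set_option linter.unusedSectionVars false

section General

variable {F Ω : Type*} [Field F] [Field Ω] [Algebra F Ω] [CharZero F] [CharZero Ω]
  [IsAlgClosed Ω] [Algebra.IsAlgebraic F Ω]

variable (F Ω) in
/-- Cyclotomic subfield. -/
def gcyc (m : ℕ) : IntermediateField F Ω :=
  IntermediateField.adjoin F {ζ : Ω | ζ ^ m = 1}

def PP (K : IntermediateField F Ω) (j m : ℕ) : Prop :=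
  ∀ σ : Ω ≃ₐ[F] Ω, σ ∈ K.fixingSubgroup → ∀ ζ : Ω, ζ ^ m = 1 → (σ ^ j) ζ = ζ

lemma algEquiv_pow_trans {K A B : Type*} [Field K] [Field A] [Field B] [Algebra K A] [Algebra K B]
    (e : A ≃ₐ[K] B) (σ : A ≃ₐ[K] A) (j : ℕ) (x : A) :
    ((e.autCongr σ) ^ j) (e x) = e ((σ ^ j) x) := by
  rw [← map_pow]
  exact congrArg (fun z => e ((σ ^ j) z)) (e.symm_apply_apply x)

lemma mem_wSet_iff (K : IntermediateField F Ω) (j m : ℕ) :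
    m ∈ wSet ↥K j ↔ 0 < m ∧ PP K j m := by
  have : IsAlgClosure ↥K Ω := ⟨‹_›, Algebra.IsAlgebraic.tower_top (K := F) ↥K⟩
  let e : AlgebraicClosure ↥K ≃ₐ[↥K] Ω := IsAlgClosure.equiv ↥K _ _
  unfold wSet PP
  simp only [Set.mem_ofPred_eq]
  refine and_congr_right fun hm => ⟨fun h σ hσ ζ hζ => ?_, fun h σ ζ hζ => ?_⟩
  · let τ := IntermediateField.fixingSubgroupEquiv K ⟨σ, hσ⟩
    have h1 := h (e.symm.autCongr τ) (e.symm ζ) (by rw [← map_pow, hζ, map_one])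
    rw [algEquiv_pow_trans] at h1
    have h2 := e.symm.injective h1
    have h3 : (τ ^ j) = IntermediateField.fixingSubgroupEquiv K (⟨σ, hσ⟩ ^ j) := by
      rw [map_pow]
    rw [h3] at h2
    exact h2
  · let τ := (IntermediateField.fixingSubgroupEquiv K).symm (e.autCongr σ)
    have h1 := h τ.1 τ.2 (e ζ) (by rw [← map_pow, hζ, map_one])
    apply e.injective
    rw [← algEquiv_pow_trans]
    have h3 : (e.autCongr σ) ^ j = IntermediateField.fixingSubgroupEquiv K (τ ^ j) := by
      rw [map_pow]; simp [τ]
    rw [h3]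
    exact h1

lemma PP_dvd {K : IntermediateField F Ω} {j m d : ℕ} (h : PP K j m) (hd : d ∣ m) : PP K j d := by
  intro σ hσ ζ hζ
  obtain ⟨c, rfl⟩ := hd
  exact h σ hσ ζ (by rw [pow_mul, hζ, one_pow])

lemma PP_mul {K : IntermediateField F Ω} {j a b : ℕ} (hab : Nat.Coprime a b) (ha : 0 < a)
    (hb : 0 < b)
    (h1 : PP K j a) (h2 : PP K j b) : PP K j (a * b) := by
  intro σ hσ ζ hζ
  have h0 : ζ ≠ 0 := by
    rintro rfl
    rw [zero_pow (by positivity)] at hζ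
    exact zero_ne_one hζ
  have e1 := h1 σ hσ (ζ ^ b) (by rw [← pow_mul, mul_comm, hζ])
  have e2 := h2 σ hσ (ζ ^ a) (by rw [← pow_mul, hζ])
  have hbz : ζ = (ζ ^ a) ^ (a.gcdA b) * (ζ ^ b) ^ (a.gcdB b) := by
    rw [← zpow_natCast, ← zpow_natCast, ← zpow_mul, ← zpow_mul, ← zpow_add₀ h0,
      ← Nat.gcd_eq_gcd_ab, hab.gcd_eq_one]
    simp
  conv_lhs => rw [hbz]
  rw [map_mul, map_zpow₀, map_zpow₀, e1, e2, ← hbz]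

lemma PP_iff_dvd {K : IntermediateField F Ω} {j N : ℕ} 
    (h : ∀ l a : ℕ, l.Prime → 0 < a → (PP K j (l ^ a) ↔ l ^ a ∣ N)) (m : ℕ) :
    0 < m → (PP K j m ↔ m ∣ N) := by
  induction m using Nat.recOnPosPrimePosCoprime with
  | prime_pow p n hp hn => exact fun _ => h p n hp hn
  | zero => exact fun h => absurd h (lt_irrefl _)
  | one =>
    intro _
    refine ⟨fun _ => one_dvd _, fun _ σ _ ζ hζ => ?_⟩
    rw [pow_one] at hζ
    rw [hζ, map_one]
  | coprime a b ha hb hab iha ihb =>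
    intro _
    refine ⟨fun hP => ?_, fun hd => ?_⟩
    · exact hab.mul_dvd_of_dvd_of_dvd ((iha (by omega)).1 (PP_dvd hP (dvd_mul_right _ _)))
        ((ihb (by omega)).1 (PP_dvd hP (dvd_mul_left _ _)))
    · exact PP_mul hab (by omega) (by omega)
        ((iha (by omega)).2 ((dvd_mul_right _ _).trans hd))
        ((ihb (by omega)).2 ((dvd_mul_left _ _).trans hd))

lemma w_eq_of {K : IntermediateField F Ω} {j N : ℕ} (hN : 0 < N)
    (h : ∀ l a : ℕ, l.Prime → 0 < a → (PP K j (l ^ a) ↔ l ^ a ∣ N)) : w ↥K j = N := by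
  unfold w
  apply IsGreatest.csSup_eq
  refine ⟨(mem_wSet_iff _ _ _).2 ⟨hN, (PP_iff_dvd h N hN).2 dvd_rfl⟩, fun m hm => ?_⟩
  obtain ⟨h1, h2⟩ := (mem_wSet_iff _ _ _).1 hm
  exact Nat.le_of_dvd hN ((PP_iff_dvd h m h1).1 h2)

lemma exists_aut (m u : ℕ) (hm : 0 < m) (hu : u.Coprime m)
    (hirr : Irreducible (Polynomial.cyclotomic m F)) :
    ∃ σ : Ω ≃ₐ[F] Ω, ∀ ζ : Ω, ζ ^ m = 1 → σ ζ = ζ ^ u := by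
  have : NeZero m := ⟨hm.ne'⟩
  obtain ⟨ζ, hζ⟩ := HasEnoughRootsOfUnity.exists_primitiveRoot Ω m
  have hc : IsConjRoot F (ζ ^ u) ζ := by
    unfold IsConjRoot
    rw [← hζ.minpoly_eq_cyclotomic_of_irreducible hirr,
      ← (hζ.pow_of_coprime u hu).minpoly_eq_cyclotomic_of_irreducible hirr]
  have : IsAlgClosure F Ω := ⟨‹_›, ‹_›⟩
  have : Normal F Ω := IsAlgClosure.normal F Ω
  obtain ⟨σ, hσ⟩ := isConjRoot_iff_exists_algEquiv.1 hc
  refine ⟨σ, fun ξ hξ => ?_⟩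
  obtain ⟨i, _, rfl⟩ := hζ.eq_pow_of_pow_eq_one hξ
  rw [map_pow, hσ, ← pow_mul, ← pow_mul, mul_comm]

lemma pow_aut {m u : ℕ} {σ : Ω ≃ₐ[F] Ω} (h : ∀ ζ : Ω, ζ ^ m = 1 → σ ζ = ζ ^ u) (j : ℕ)
   (ζ : Ω) (hζ : ζ ^ m = 1) : (σ ^ j) ζ = ζ ^ (u ^ j) := by
  induction j with
  | zero => simp
  | succ n ih =>
    rw [pow_succ', AlgEquiv.mul_apply, ih, map_pow, h ζ hζ, ← pow_mul, pow_succ']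

lemma exists_exp (m : ℕ) (hm : 0 < m) (σ : Ω ≃ₐ[F] Ω) :
    ∃ u : ℕ, u.Coprime m ∧ ∀ ζ : Ω, ζ ^ m = 1 → σ ζ = ζ ^ u := by
  have : NeZero m := ⟨hm.ne'⟩
  obtain ⟨ζ, hζ⟩ := HasEnoughRootsOfUnity.exists_primitiveRoot Ω m
  have h1 : IsPrimitiveRoot (σ ζ) m := hζ.map_of_injective σ.injective
  obtain ⟨u, _, hu⟩ := hζ.eq_pow_of_pow_eq_one h1.pow_eq_one
  refine ⟨u, ?_, fun ξ hξ => ?_⟩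
  · rw [← hu] at h1
    exact (hζ.pow_iff_coprime hm u).1 h1
  obtain ⟨i, _, rfl⟩ := hζ.eq_pow_of_pow_eq_one hξ
  rw [map_pow, ← hu, ← pow_mul, ← pow_mul, mul_comm]

lemma pow_eq_pow_iff_prim {m n i : ℕ} (hm : 0 < m) {ζ : Ω} (hζ : IsPrimitiveRoot ζ m) :
    ζ ^ n = ζ ^ i ↔ n ≡ i [MOD m] := by
  have hf : IsOfFinOrder ζ := isOfFinOrder_iff_pow_eq_one.2 ⟨m, hm, hζ.pow_eq_one⟩
  rw [hf.pow_eq_pow_iff_modEq, ← hζ.eq_orderOf]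

variable (Ω) in
lemma pow_eq_iff_of (m n : ℕ) (hm : 0 < m) : 
    (∀ ζ : Ω, ζ ^ m = 1 → ζ ^ n = ζ) ↔ ((n : ZMod m) = 1) := by
  have : NeZero m := ⟨hm.ne'⟩
  rw [show ((1 : ZMod m)) = ((1:ℕ) : ZMod m) by simp, ZMod.natCast_eq_natCast_iff]
  obtain ⟨ζ, hζ⟩ := HasEnoughRootsOfUnity.exists_primitiveRoot Ω m
  constructor
  · intro h
    have := h ζ hζ.pow_eq_one
    have h2 : ζ ^ n = ζ ^ 1 := by rw [this, pow_one]
    exact (pow_eq_pow_iff_prim hm hζ).1 h2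
  · intro h ξ hξ
    obtain ⟨i, _, rfl⟩ := hζ.eq_pow_of_pow_eq_one hξ
    rw [← pow_mul, mul_comm, pow_mul, (pow_eq_pow_iff_prim hm hζ).2 h, pow_one]

lemma mem_fix_of {K : IntermediateField F Ω} {q : ℕ} (hsub : K ≤ gcyc F Ω q)
    (σ : Ω ≃ₐ[F] Ω) (h : ∀ ζ : Ω, ζ ^ q = 1 → σ ζ = ζ) : σ ∈ K.fixingSubgroup := by
  apply IntermediateField.fixingSubgroup_antitone hsub
  rw [← Subgroup.zpowers_le, ← IntermediateField.le_iff_le, gcyc,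
    IntermediateField.adjoin_le_iff]
  intro ζ hζ
  rintro ⟨τ, hτ⟩
  obtain ⟨n, rfl⟩ := Subgroup.mem_zpowers_iff.1 hτ
  have h1 : σ ∈ MulAction.stabilizer (Ω ≃ₐ[F] Ω) ζ := h ζ hζ
  exact (MulAction.stabilizer (Ω ≃ₐ[F] Ω) ζ).zpow_mem h1 n

instance cyc_inst (q : ℕ) [NeZero q] : IsCyclotomicExtension {q} F ↥(gcyc F Ω q) := by
  have hq : q ≠ 0 := NeZero.ne q
  have := IntermediateField.isCyclotomicExtension_adjoin_of_exists_isPrimitiveRoot {q} F Ω 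
    (fun n hn h0 => by
      have : NeZero n := ⟨h0⟩
      exact HasEnoughRootsOfUnity.exists_primitiveRoot Ω n)
  have e : {b : Ω | ∃ n ∈ ({q} : Set ℕ), n ≠ 0 ∧ b ^ n = 1} = {ζ | ζ ^ q = 1} := by
    ext; simp [hq]
  rw [e] at this
  exact this

lemma pow_mem_fix {K : IntermediateField F Ω} {q : ℕ} [NeZero q] (hsub : K ≤ gcyc F Ω q)
    (σ : Ω ≃ₐ[F] Ω) : σ ^ (finrank F ↥K) ∈ K.fixingSubgroup := by
  have := IsCyclotomicExtension.isAbelianGalois {q} F ↥(gcyc F Ω q)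
  have : IsAbelianGalois F ↥K := .of_algHom (IntermediateField.inclusion hsub)
  have : FiniteDimensional F ↥(gcyc F Ω q) := IsCyclotomicExtension.finiteDimensional {q} F _
  have : FiniteDimensional F ↥K := FiniteDimensional.of_injective
    (IntermediateField.inclusion hsub).toLinearMap (IntermediateField.inclusion hsub).injective
  rw [← IntermediateField.restrictNormalHom_ker, MonoidHom.mem_ker, map_pow,
    ← IsGalois.card_aut_eq_finrank]
  exact pow_card_eq_one'

lemma finrank_cyc {q : ℕ} (hq : q.Prime)
    (hirr : Irreducible (Polynomial.cyclotomic q F)) : finrank F ↥(gcyc F Ω q) = q - 1 := by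
  have : NeZero q := ⟨hq.ne_zero⟩
  rw [IsCyclotomicExtension.finrank (n := q) _ (hirr), Nat.totient_prime hq]

lemma finrank_restrict {K : IntermediateField F Ω} {q : ℕ} (hq : q.Prime)
    (hirr : Irreducible (Polynomial.cyclotomic q F)) (hsub : K ≤ gcyc F Ω q) :
    finrank F ↥K * finrank ↥(IntermediateField.restrict hsub) ↥(gcyc F Ω q) = q - 1 := by
  rw [← finrank_cyc (Ω := Ω) hq hirr, (IntermediateField.restrictAlgEquiv hsub).toLinearEquiv.finrank_eq,
    finrank_mul_finrank]

lemma pow_fix {K : IntermediateField F Ω} {q : ℕ} (hq : q.Prime)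
    (hirr : Irreducible (Polynomial.cyclotomic q F)) (hsub : K ≤ gcyc F Ω q)
    (hpos : 0 < finrank F ↥K)
    (σ : Ω ≃ₐ[F] Ω) (hσ : σ ∈ K.fixingSubgroup) (ζ : Ω) (hζ : ζ ^ q = 1) :
    (σ ^ ((q - 1) / finrank F ↥K)) ζ = ζ := by
  have : NeZero q := ⟨hq.ne_zero⟩
  have := IsCyclotomicExtension.isAbelianGalois {q} F ↥(gcyc F Ω q)
  have : FiniteDimensional F ↥(gcyc F Ω q) := IsCyclotomicExtension.finiteDimensional {q} F _
  rw [← finrank_restrict hq hirr hsub, Nat.mul_div_cancel_left _ hpos]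
  let τ := AlgEquiv.restrictNormalHom ↥(gcyc F Ω q) σ
  have hτ : τ ∈ (IntermediateField.restrict hsub).fixingSubgroup := by
    rintro ⟨x, hx⟩
    replace hx : x ∈ IntermediateField.restrict hsub := hx
    rw [IntermediateField.mem_restrict] at hx
    apply Subtype.ext
    have := AlgEquiv.restrictNormal_commutes σ ↥(gcyc F Ω q) x
    exact this.trans (hσ ⟨x.1, hx⟩)
  have h1 : (⟨τ, hτ⟩ : (IntermediateField.restrict hsub).fixingSubgroup) ^
      (finrank ↥(IntermediateField.restrict hsub) ↥(gcyc F Ω q)) = 1 := by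
    rw [← IsGalois.card_fixingSubgroup_eq_finrank]
    exact pow_card_eq_one'
  have h2 : τ ^ (finrank ↥(IntermediateField.restrict hsub) ↥(gcyc F Ω q)) = 1 :=
    congrArg Subtype.val h1
  rw [← map_pow] at h2
  have h3 := AlgEquiv.restrictNormal_commutes
    (σ ^ (finrank ↥(IntermediateField.restrict hsub) ↥(gcyc F Ω q))) ↥(gcyc F Ω q)
    ⟨ζ, IntermediateField.subset_adjoin _ _ hζ⟩
  have h4 := DFunLike.congr_fun h2 (⟨ζ, IntermediateField.subset_adjoin _ _ hζ⟩ : ↥(gcyc F Ω q))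
  refine h3.symm.trans ?_
  exact congrArg Subtype.val h4

end General
section General2

variable {F Ω : Type*} [Field F] [Field Ω] [Algebra F Ω] [CharZero F] [CharZero Ω]
  [IsAlgClosed Ω] [Algebra.IsAlgebraic F Ω]

lemma PP_iff_carm (hirr : ∀ n, 0 < n → Irreducible (Polynomial.cyclotomic n F))
    {K : IntermediateField F Ω} {q m j : ℕ} (hq : 0 < q) (hm : 0 < m) (hqm : q.Coprime m)
    (hsub : K ≤ gcyc F Ω q) : PP K j m ↔ ArithmeticFunction.carmichael m ∣ j := by
  rw [ArithmeticFunction.carmichael_eq_exponent hm.ne', Monoid.exponent_dvd_iff_forall_pow_eq_one]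
  constructor
  · intro h u
    have : NeZero m := ⟨hm.ne'⟩
    obtain ⟨x, hx1, hx2⟩ := Nat.chineseRemainder hqm 1 (u : ZMod m).val
    have hxu : ((x : ℕ) : ZMod m) = u := by
      rw [(ZMod.natCast_eq_natCast_iff _ _ _).2 hx2, ZMod.natCast_zmod_val]
    have hxm : x.Coprime m := (ZMod.isUnit_iff_coprime x m).1 (hxu ▸ u.isUnit)
    have hxq : x.Coprime q := by
      have := hx1.gcd_eq
      rw [Nat.gcd_one_left] at this
      exact this
    obtain ⟨σ, hσ⟩ := exists_aut (Ω := Ω) (q * m) x (by positivity) (hxq.mul_right hxm)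
      (hirr _ (by positivity))
    have hσm : ∀ ζ : Ω, ζ ^ m = 1 → σ ζ = ζ ^ x :=
      fun ζ hζ => hσ ζ (by rw [mul_comm, pow_mul, hζ, one_pow])
    have hσq : ∀ ζ : Ω, ζ ^ q = 1 → σ ζ = ζ := fun ζ hζ => by
      rw [hσ ζ (by rw [pow_mul, hζ, one_pow])]
      exact (pow_eq_iff_of Ω q x hq).2 (by
        simpa using (ZMod.natCast_eq_natCast_iff _ _ _).2 hx1) ζ hζ
    have h1 := (pow_eq_iff_of Ω m (x ^ j) hm).1 (fun ζ hζ => by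
      rw [← pow_aut hσm j ζ hζ]
      exact h σ (mem_fix_of hsub σ hσq) ζ hζ)
    apply Units.ext
    push_cast at h1 ⊢
    rw [← hxu, h1]
  · intro h σ hσ ζ hζ
    obtain ⟨x, hx, hσx⟩ := exists_exp m hm σ
    rw [pow_aut hσx j ζ hζ]
    refine (pow_eq_iff_of Ω m (x ^ j) hm).2 ?_ ζ hζ
    have := congrArg Units.val (h (ZMod.unitOfCoprime x hx))
    simpa using this

lemma PP_q_iff (hirr : ∀ n, 0 < n → Irreducible (Polynomial.cyclotomic n F))
    {K : IntermediateField F Ω} {p q a j : ℕ} (hq : q.Prime) (hq2 : q ≠ 2)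
    (hp : finrank F ↥K = p) (hp0 : 0 < p)
    (hsub : K ≤ gcyc F Ω q) : PP K j (q ^ (a + 1)) ↔ q ^ a * ((q - 1) / p) ∣ j := by
  have hm : 0 < q ^ (a + 1) := pow_pos hq.pos _
  have : NeZero q := ⟨hq.ne_zero⟩
  have hpq : p * ((q - 1) / p) = q - 1 := 
    Nat.mul_div_cancel' ⟨_, hp ▸ (finrank_restrict hq (hirr q hq.pos) hsub).symm⟩
  constructor
  · intro h
    have h2 : ArithmeticFunction.carmichael (q ^ (a + 1)) ∣ p * j := by
      rw [ArithmeticFunction.carmichael_eq_exponent hm.ne',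
        Monoid.exponent_dvd_iff_forall_pow_eq_one]
      intro u
      have hc := ZMod.val_coe_unit_coprime u
      obtain ⟨σ, hσ⟩ := exists_aut (Ω := Ω) (q ^ (a + 1)) _ hm hc (hirr _ hm)
      have h1 := (pow_eq_iff_of Ω _ ((u : ZMod (q ^ (a + 1))).val ^ (p * j)) hm).1
        (fun ζ hζ => by
          rw [← pow_aut hσ _ ζ hζ, pow_mul]
          exact h _ (hp ▸ pow_mem_fix hsub σ) ζ hζ)
      apply Units.ext
      simpa using h1
    rw [ArithmeticFunction.carmichael_pow_of_prime_ne_two _ hq hq2,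
      Nat.totient_prime_pow hq (by omega), Nat.add_sub_cancel, ← hpq, mul_left_comm] at h2
    exact Nat.dvd_of_mul_dvd_mul_left hp0 h2
  · intro h σ hσ ζ hζ
    obtain ⟨x, hx, hσx⟩ := exists_exp (q ^ (a + 1)) hm σ
    rw [pow_aut hσx j ζ hζ]
    refine (pow_eq_iff_of Ω _ (x ^ j) hm).2 ?_ ζ hζ
    have hσq : ∀ ζ : Ω, ζ ^ q = 1 → σ ζ = ζ ^ x := fun ζ hζ =>
      hσx ζ (by rw [pow_succ', pow_mul, hζ, one_pow])
    have h1 := (pow_eq_iff_of Ω q (x ^ ((q - 1) / p)) hq.pos).1 (fun ζ hζ => by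
      rw [← pow_aut hσq _ ζ hζ, ← hp]
      exact pow_fix hq (hirr q hq.pos) hsub (hp ▸ hp0) σ hσ ζ hζ)
    have h2 : (q : ℤ) ∣ (x : ℤ) ^ ((q - 1) / p) - 1 := by
      rw [← ZMod.intCast_zmod_eq_zero_iff_dvd]
      push_cast at h1 ⊢
      rw [h1, sub_self]
    have h3 := dvd_sub_pow_of_dvd_sub h2 a
    have h4 : ((x : ZMod (q ^ (a + 1))) ^ ((q - 1) / p)) ^ (q ^ a) = 1 := by
      rw [← sub_eq_zero]
      have := (ZMod.intCast_zmod_eq_zero_iff_dvd _ (q ^ (a + 1))).2 (by exact_mod_cast h3)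
      push_cast at this
      simpa using this
    obtain ⟨c, rfl⟩ := h
    push_cast
    rw [mul_comm (q ^ a), pow_mul, pow_mul, h4, one_pow]

end General2

lemma arith_odd {l a c k : ℕ} (hl : l.Prime) (hl2 : l ≠ 2) (hk : 1 ≤ k) (hc : l.Coprime c) :
    l ^ a * c ∣ 2 * k ↔ c ∣ 2 * k ∧ a ≤ padicValNat l k := by
  have : Fact l.Prime := ⟨hl⟩
  have h1 : l ^ a ∣ 2 * k ↔ a ≤ padicValNat l k := by
    rw [← padicValNat_dvd_iff_le (by omega : k ≠ 0)]
    exact Nat.Coprime.dvd_mul_left (Nat.Coprime.pow_left _ ((Nat.coprime_primes hl Nat.prime_two).2 hl2))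
  rw [← h1]
  exact ⟨fun h => ⟨(dvd_mul_left _ _).trans h, (dvd_mul_right _ _).trans h⟩,
    fun h => (hc.pow_left a).mul_dvd_of_dvd_of_dvd h.2 h.1⟩

lemma carm_odd {l a k : ℕ} (hl : l.Prime) (hl2 : l ≠ 2) (hk : 1 ≤ k) (ha : 0 < a) :
    ArithmeticFunction.carmichael (l ^ a) ∣ 2 * k ↔
      a ≤ if (l - 1) ∣ 2 * k then 1 + padicValNat l k else 0 := by
  obtain ⟨a, rfl⟩ : ∃ b, a = b + 1 := ⟨a - 1, by omega⟩
  rw [ArithmeticFunction.carmichael_pow_of_prime_ne_two _ hl hl2,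
      Nat.totient_prime_pow hl (by omega), Nat.add_sub_cancel, arith_odd hl hl2 hk]
  · split_ifs with h
    · simp only [h, true_and]; omega
    · simp [h]
  · rw [Nat.coprime_comm]
    exact (Nat.coprime_self_sub_left hl.one_le).2 (Nat.coprime_one_left l)

lemma carm_two {a k : ℕ} (hk : 1 ≤ k) :
    ArithmeticFunction.carmichael (2 ^ a) ∣ 2 * k ↔ a ≤ 3 + padicValNat 2 k := by
  by_cases h : a = 2
  · subst h
    rw [ArithmeticFunction.carmichael_two_pow_of_le_two le_rfl]
    simp; omega
  · rw [ArithmeticFunction.carmichael_two_pow_of_ne_two h, padicValNat_dvd_iff_le (by omega),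
      padicValNat.mul (by norm_num) (by omega)]
    simp; omega

lemma fact_N {q k A B l : ℕ} (hq : q.Prime) (hq2 : q ≠ 2) (hk : 1 ≤ k) (hl : l.Prime)
    (e : ℕ → ℕ) {N : ℕ} (hN : N = 2 ^ A * q ^ B *
        ∏ᶠ (ℓ : ℕ) (_ : ℓ.Prime ∧ ℓ ≠ 2 ∧ ℓ ≠ q ∧ (ℓ - 1) ∣ 2 * k), ℓ ^ (e ℓ)) :
    0 < N ∧ N.factorization l = if l = 2 then A else if l = q then B else
      if (l - 1) ∣ 2 * k then e l else 0 := by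
  let S : Finset ℕ := (Finset.range (2 * k + 2)).filter
    (fun ℓ => ℓ.Prime ∧ ℓ ≠ 2 ∧ ℓ ≠ q ∧ (ℓ - 1) ∣ 2 * k)
  have hS : ∀ x, x ∈ S ↔ (x.Prime ∧ x ≠ 2 ∧ x ≠ q ∧ (x - 1) ∣ 2 * k) := by
    intro x
    simp only [S, Finset.mem_filter, Finset.mem_range, and_iff_right_iff_imp]
    rintro ⟨_, _, _, h⟩
    have := Nat.le_of_dvd (by omega) h
    omega
  rw [finprod_cond_eq_prod_of_cond_iff (t := S) _ (fun {x} _ => (hS x).symm)] at hN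
  have hne : ∀ x ∈ S, x ^ e x ≠ 0 := fun x hx => pow_ne_zero _ ((hS x).1 hx).1.ne_zero
  have hP : (∏ x ∈ S, x ^ e x) ≠ 0 := Finset.prod_ne_zero_iff.2 hne
  have h2 : (2 ^ A : ℕ) ≠ 0 := by positivity
  have hqB : q ^ B ≠ 0 := pow_ne_zero _ hq.ne_zero
  refine ⟨by rw [hN]; positivity, ?_⟩
  have hf : (∏ x ∈ S, x ^ e x).factorization l = if l ∈ S then e l else 0 := by
    rw [Nat.factorization_prod hne, Finsupp.finsetSum_apply, 
      Finset.sum_congr rfl (g := fun x => if l = x then e x else 0)]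
    · simp
    · intro x hx
      rw [((hS x).1 hx).1.factorization_pow, Finsupp.single_apply]
      simp [eq_comm]
  rw [hN, Nat.factorization_mul (mul_ne_zero h2 hqB) hP, Nat.factorization_mul h2 hqB,
    Nat.prime_two.factorization_pow, hq.factorization_pow]
  simp only [Finsupp.add_apply, hf, hS, Finsupp.single_apply, hl, true_and]
  by_cases h : l = 2
  · subst h; simp [hq2]
  by_cases h' : l = q
  · subst h'; simp [h, Ne.symm h]
  simp [h, h', Ne.symm h, Ne.symm h']

theorem w_of_totallyReal_degree_p_subfield_of_cyclotomic_q
    (p q : ℕ) (hp : p.Prime) (hq : q.Prime) (hqodd : q ≠ 2)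
    (K : IntermediateField ℚ (AlgebraicClosure ℚ))
    (hsub : K ≤ cycField q) (hreal : IsTotallyReal ↥K)
    (hdeg : finrank ℚ ↥K = p)
    (k : ℕ) (hk : 1 ≤ k) :
    w ↥K (2 * k) = 2 ^ (3 + padicValNat 2 k) *
        q ^ ((1 + padicValNat q k) * (if (q - 1) / p ∣ 2 * k then 1 else 0)) *
        ∏ᶠ (ℓ : ℕ) (_ : ℓ.Prime ∧ ℓ ≠ 2 ∧ ℓ ≠ q ∧ (ℓ - 1) ∣ 2 * k),
          ℓ ^ (1 + padicValNat ℓ k) := by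
  have halg : Algebra.IsAlgebraic ℚ (AlgebraicClosure ℚ) := by
    have h := AlgebraicClosure.isAlgebraic ℚ
    rwa [Subsingleton.elim (AlgebraicClosure.instAlgebra ℚ) DivisionRing.toRatAlgebra] at h
  have hirr : ∀ n, 0 < n → Irreducible (Polynomial.cyclotomic n ℚ) :=
    fun n hn => Polynomial.cyclotomic.irreducible_rat hn
  have hsub' : K ≤ gcyc ℚ (AlgebraicClosure ℚ) q := hsub
  have hN := fun l hl => fact_N (A := 3 + padicValNat 2 k)
    (B := (1 + padicValNat q k) * (if (q - 1) / p ∣ 2 * k then 1 else 0)) (l := l) hq hqodd hk hl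
    (fun ℓ => 1 + padicValNat ℓ k) rfl
  refine w_eq_of (hN 2 Nat.prime_two).1 fun l a hl ha => ?_
  rw [hl.pow_dvd_iff_le_factorization (hN 2 Nat.prime_two).1.ne', (hN l hl).2]
  by_cases h2 : l = 2
  · subst h2
    rw [if_pos rfl, ← carm_two hk]
    exact PP_iff_carm hirr hq.pos (by positivity)
      (Nat.Coprime.pow_right _ ((Nat.coprime_primes hq Nat.prime_two).2 hqodd)) hsub'
  rw [if_neg h2]
  by_cases hlq : l = q
  · subst hlq
    obtain ⟨b, rfl⟩ : ∃ b, a = b + 1 := ⟨a - 1, by omega⟩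
    have hpq : p * ((l - 1) / p) = l - 1 := 
      Nat.mul_div_cancel' ⟨_, hdeg ▸ (finrank_restrict hq (hirr l hq.pos) hsub').symm⟩
    have hco : l.Coprime ((l - 1) / p) := by
      apply Nat.Coprime.coprime_dvd_right ⟨p, by rw [mul_comm, hpq]⟩
      rw [Nat.coprime_comm]
      exact (Nat.coprime_self_sub_left hl.one_le).2 (Nat.coprime_one_left l)
    rw [if_pos rfl, PP_q_iff hirr hq hqodd hdeg hp.pos hsub', arith_odd hq hqodd hk hco]
    split_ifs with h
    · simp only [h, true_and]; omega
    · simp [h]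
  · rw [if_neg hlq, ← carm_odd hl h2 hk ha]
    exact PP_iff_carm hirr hq.pos (pow_pos hl.pos _)
      (Nat.Coprime.pow_right _ ((Nat.coprime_primes hq hl).2 (Ne.symm hlq))) hsub'
end
end

section
/- Let p be a prime and let K be a totally real cyclic extension of ℚ of degree p such that K ≠ ℚ(√2), K is not contained in ℚ(ζ_{p²}) (this condition being relevant only for p odd), and K is not contained in ℚ(ζ_q) for any odd prime q. Then for every integer k ≥ 1 one has w_{2k}(K) = ∏_{ℓ} ℓ^{1 + v_ℓ(4k)}, the product being taken over all primes ℓ such that ℓ − 1 divides 2k; equivalently, w_{2k}(K) = 2^{3 + v_2(k)} · ∏_{ℓ odd, (ℓ−1) ∣ 2k} ℓ^{1 + v_ℓ(k)}. -/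
open scoped Classical
noncomputable section

open Module

lemma carm_dvd_iff (l n k : ℕ) (hl : l.Prime) (hn : 1 ≤ n) (hk : 1 ≤ k) :
    ArithmeticFunction.carmichael (l ^ n) ∣ 2 * k ↔
      (l - 1) ∣ 2 * k ∧ n ≤ 1 + padicValNat l (4 * k) := by
  have := Fact.mk hl
  obtain ⟨n, rfl⟩ : ∃ m, n = m + 1 := ⟨n - 1, by omega⟩
  have h4 : 4 * k ≠ 0 := by omega
  have e : n + 1 ≤ 1 + padicValNat l (4 * k) ↔ l ^ n ∣ 4 * k := by
    rw [padicValNat_dvd_iff_le h4]; omega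
  rw [e]
  by_cases h2 : l = 2
  · subst h2
    have : 2 ^ n ∣ 4 * k ↔ ArithmeticFunction.carmichael (2 ^ (n + 1)) ∣ 2 * k := by
      rcases n with _ | _ | n
      · rw [ArithmeticFunction.carmichael_two_pow_of_le_two (by norm_num)]; simp
      · rw [ArithmeticFunction.carmichael_two_pow_of_le_two (by norm_num)]; simp
        omega
      · rw [ArithmeticFunction.carmichael_two_pow_of_ne_two (by omega)]
        rw [show 4 * k = 2 * (2 * k) by ring, pow_succ', show n + 1 + 1 + 1 - 2 = n + 1 by omega]
        exact Nat.mul_dvd_mul_iff_left (by norm_num)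
    rw [this]; simp
  · rw [ArithmeticFunction.carmichael_pow_of_prime_ne_two _ hl h2,
      Nat.totient_prime_pow hl (by omega), Nat.add_sub_cancel]
    have hc : Nat.Coprime (l ^ n) (l - 1) := by
      apply Nat.Coprime.pow_left
      exact (Nat.coprime_self_sub_right hl.one_lt.le).2 (Nat.coprime_one_right _)
    have hc2 : Nat.Coprime (l ^ n) 2 :=
      Nat.Coprime.pow_left _ ((Nat.coprime_primes hl Nat.prime_two).2 h2)
    rw [show 4 * k = 2 * (2 * k) by ring, hc2.dvd_mul_left]
    exact ⟨fun h => ⟨(Dvd.intro_left _ rfl).trans h, (Dvd.intro _ rfl).trans h⟩,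
      fun h => hc.mul_dvd_of_dvd_of_dvd h.2 h.1⟩

lemma arith_final (k : ℕ) (hk : 1 ≤ k) (S : Set ℕ)
    (hS : ∀ m, m ∈ S ↔ 0 < m ∧ ArithmeticFunction.carmichael m ∣ 2 * k) :
    (sSup S = ∏ᶠ (ℓ : ℕ) (_ : ℓ.Prime ∧ (ℓ - 1) ∣ 2 * k),
        ℓ ^ (1 + padicValNat ℓ (4 * k))) ∧
    (sSup S = 2 ^ (3 + padicValNat 2 k) *
        ∏ᶠ (ℓ : ℕ) (_ : ℓ.Prime ∧ ℓ ≠ 2 ∧ (ℓ - 1) ∣ 2 * k),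
          ℓ ^ (1 + padicValNat ℓ k)) := by
  set T := (Finset.range (2 * k + 2)).filter (fun l : ℕ => l.Prime ∧ (l - 1) ∣ 2 * k) with hT
  have memT : ∀ l, l ∈ T ↔ l.Prime ∧ (l - 1) ∣ 2 * k := by
    intro l
    simp only [hT, Finset.mem_filter, Finset.mem_range, and_iff_right_iff_imp]
    rintro ⟨h1, h2⟩
    have := Nat.le_of_dvd (by omega) h2
    omega
  set e : ℕ → ℕ := fun l => 1 + padicValNat l (4 * k) with he
  have f1 : ∏ᶠ (ℓ : ℕ) (_ : ℓ.Prime ∧ (ℓ - 1) ∣ 2 * k), ℓ ^ (1 + padicValNat ℓ (4 * k))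
      = ∏ l ∈ T, l ^ e l := by
    apply finprod_mem_eq_prod_of_inter_mulSupport_eq
    congr 1
    ext l
    simp only [Finset.mem_coe, memT]; rfl
  have f2 : ∏ᶠ (ℓ : ℕ) (_ : ℓ.Prime ∧ ℓ ≠ 2 ∧ (ℓ - 1) ∣ 2 * k), ℓ ^ (1 + padicValNat ℓ k)
      = ∏ l ∈ T.erase 2, l ^ (1 + padicValNat l k) := by
    apply finprod_mem_eq_prod_of_inter_mulSupport_eq
    congr 1
    ext l
    simp only [Finset.coe_erase, Set.mem_sdiff, Finset.mem_coe, memT, Set.mem_singleton_iff]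
    change (l.Prime ∧ l ≠ 2 ∧ (l - 1) ∣ 2 * k) ↔ _
    tauto
  have f3 : ∏ l ∈ T, l ^ e l
      = 2 ^ (3 + padicValNat 2 k) * ∏ l ∈ T.erase 2, l ^ (1 + padicValNat l k) := by
    rw [← Finset.mul_prod_erase T _ ((memT 2).2 ⟨Nat.prime_two, by simp⟩)]
    congr 1
    · have : padicValNat 2 (4 * k) = 2 + padicValNat 2 k := by
        rw [padicValNat.mul (by norm_num) (by omega), show 4 = 2 ^ 2 by norm_num,
          padicValNat.prime_pow]
      simp only [he, this]
      congr 1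
      omega
    · apply Finset.prod_congr rfl
      intro l hl
      rw [Finset.mem_erase, memT] at hl
      have := Fact.mk hl.2.1
      have : padicValNat l (4 * k) = padicValNat l k := by
        rw [padicValNat.mul (by norm_num) (by omega), show 4 = 2 ^ 2 by norm_num,
          padicValNat.pow, padicValNat_primes hl.1]
        simp
      simp only [he, this]
  have hpos : 0 < ∏ l ∈ T, l ^ e l := by
    apply Finset.prod_pos
    intro l hl
    exact pow_pos ((memT l).1 hl).1.pos _
  have key : sSup S = ∏ l ∈ T, l ^ e l := by
    apply IsGreatest.csSup_eq
    constructor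
    · rw [hS]
      refine ⟨hpos, ?_⟩
      rw [ArithmeticFunction.carmichael_finsetProd]
      · apply Finset.lcm_dvd
        intro l hl
        have h := (memT l).1 hl
        exact (carm_dvd_iff l (e l) k h.1 (by simp [he]) hk).2 ⟨h.2, le_rfl⟩
      · intro a ha b hb hab
        exact Nat.Coprime.pow _ _ ((Nat.coprime_primes ((memT a).1 ha).1 ((memT b).1 hb).1).2 hab)
    · intro m hm
      rw [hS] at hm
      apply Nat.le_of_dvd hpos
      rw [← Nat.prod_factorization_pow_eq_self hm.1.ne']
      have hh : ∀ l ∈ m.primeFactors, l ∈ T ∧ m.factorization l ≤ e l := by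
        intro l hl
        have hlp := Nat.prime_of_mem_primeFactors hl
        have h1 : 1 ≤ m.factorization l :=
          (hlp.dvd_iff_one_le_factorization hm.1.ne').1 (Nat.dvd_of_mem_primeFactors hl)
        have := (carm_dvd_iff l (m.factorization l) k hlp h1 hk).1
          ((ArithmeticFunction.carmichael_dvd (Nat.ordProj_dvd m l)).trans hm.2)
        exact ⟨(memT l).2 ⟨hlp, this.1⟩, this.2⟩
      rw [Finsupp.prod, Nat.support_factorization]
      calc _ ∣ ∏ l ∈ m.primeFactors, l ^ e l :=
            Finset.prod_dvd_prod_of_dvd _ _ fun l hl => pow_dvd_pow _ (hh l hl).2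
        _ ∣ _ := Finset.prod_dvd_prod_of_subset _ _ _ fun l hl => (hh l hl).1
  rw [f1, f2, ← f3]
  exact ⟨key, key⟩

lemma isAlg_gen (k : Type*) [Field k] : Algebra.IsAlgebraic k (AlgebraicClosure k) := inferInstance

lemma isAlg_rat (Ω : Type*) [Field Ω] [CharZero Ω] (A : Algebra ℚ Ω)
    (h : @Algebra.IsAlgebraic ℚ Ω _ _ A) : @Algebra.IsAlgebraic ℚ Ω _ _ DivisionRing.toRatAlgebra := by
  obtain rfl : A = DivisionRing.toRatAlgebra := Subsingleton.elim _ _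
  exact h

instance instAlgQ : Algebra.IsAlgebraic ℚ (AlgebraicClosure ℚ) := isAlg_rat _ _ (isAlg_gen ℚ)
instance instClosQ : IsAlgClosure ℚ (AlgebraicClosure ℚ) := ⟨inferInstance, inferInstance⟩
instance instNormQ : Normal ℚ (AlgebraicClosure ℚ) := IsAlgClosure.normal ℚ (AlgebraicClosure ℚ)
instance instGalQ : IsGalois ℚ (AlgebraicClosure ℚ) where

lemma exists_chi (m : ℕ) (hm : 0 < m) :
    ∃ χ : (AlgebraicClosure ℚ ≃ₐ[ℚ] AlgebraicClosure ℚ) →* (ZMod m)ˣ,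
      Function.Surjective χ ∧
      ∀ g, ∀ ζ : AlgebraicClosure ℚ, ζ ^ m = 1 → g ζ = ζ ^ ((χ g : ZMod m).val) := by
  have : NeZero m := ⟨hm.ne'⟩
  obtain ⟨z, hz⟩ := HasEnoughRootsOfUnity.exists_primitiveRoot (AlgebraicClosure ℚ) m
  have spec : ∀ g : AlgebraicClosure ℚ ≃ₐ[ℚ] AlgebraicClosure ℚ,
      ∀ ζ : AlgebraicClosure ℚ, ζ ^ m = 1 →
        g ζ = ζ ^ ((hz.autToPow ℚ g : ZMod m).val) := by
    intro g ζ hζ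
    obtain ⟨i, -, rfl⟩ := hz.eq_pow_of_pow_eq_one hζ
    rw [map_pow, ← hz.autToPow_spec ℚ g, ← pow_mul, ← pow_mul, mul_comm]
  refine ⟨hz.autToPow ℚ, ?_, spec⟩
  intro u
  have hcop : (u : ZMod m).val.Coprime m := ZMod.val_coe_unit_coprime u
  have hz2 := hz.pow_of_coprime _ hcop
  have hmin : minpoly ℚ z = minpoly ℚ (z ^ (u : ZMod m).val) := by
    rw [← Polynomial.cyclotomic_eq_minpoly_rat hz hm, ← Polynomial.cyclotomic_eq_minpoly_rat hz2 hm]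
  obtain ⟨σ, hσ⟩ := minpoly.exists_algEquiv_of_root (K := ℚ) (x := z)
    (y := z ^ (u : ZMod m).val) (Algebra.IsAlgebraic.isAlgebraic _) (by rw [← hmin]; exact minpoly.aeval _ _)
  refine ⟨σ, ?_⟩
  have := spec σ z hz.pow_eq_one
  rw [hσ] at this
  have := hz.pow_inj (ZMod.val_lt _) (ZMod.val_lt _) this
  exact (Units.ext (ZMod.val_injective m this)).symm

lemma le_adjoin_of_fix (K : IntermediateField ℚ (AlgebraicClosure ℚ))
    (S : Set (AlgebraicClosure ℚ))
    (h : ∀ τ : AlgebraicClosure ℚ ≃ₐ[ℚ] AlgebraicClosure ℚ, (∀ x ∈ S, τ x = x) →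
      ∀ x ∈ K, τ x = x) : K ≤ IntermediateField.adjoin ℚ S := by
  rw [← InfiniteGalois.fixedField_fixingSubgroup (IntermediateField.adjoin ℚ S)]
  intro x hx
  rw [IntermediateField.mem_fixedField_iff]
  intro τ hτ
  rw [IntermediateField.mem_fixingSubgroup_iff] at hτ
  exact h τ (fun y hy => hτ y (IntermediateField.subset_adjoin ℚ S hy)) x hx

lemma chi_modEq (m m0 : ℕ) (hm : 0 < m) (hd : m0 ∣ m) (τ : AlgebraicClosure ℚ ≃ₐ[ℚ] AlgebraicClosure ℚ)
    (a : ℕ) (ha : ∀ ζ : AlgebraicClosure ℚ, ζ ^ m = 1 → τ ζ = ζ ^ a)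
    (hf : ∀ ζ : AlgebraicClosure ℚ, ζ ^ m0 = 1 → τ ζ = ζ) : (m0 : ℤ) ∣ (a : ℤ) - 1 := by
  have : NeZero m0 := ⟨fun h => by subst h; simp at hd; omega⟩
  obtain ⟨z, hz⟩ := HasEnoughRootsOfUnity.exists_primitiveRoot (AlgebraicClosure ℚ) m0
  have h1 := hf z hz.pow_eq_one
  obtain ⟨c, rfl⟩ := hd
  rw [ha z (by rw [pow_mul, hz.pow_eq_one, one_pow])] at h1
  rw [← hz.zpow_eq_one_iff_dvd, zpow_sub₀ (hz.ne_zero (NeZero.ne m0)), zpow_natCast, h1, zpow_one,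
    div_self (hz.ne_zero (NeZero.ne m0))]

lemma pow_step (p j : ℕ) (hj : 1 ≤ j) (i : ℕ) (a : ℤ) (h : (p : ℤ) ^ j ∣ a - 1) :
    (p : ℤ) ^ (j + i) ∣ a ^ (p ^ i) - 1 := by
  induction i with
  | zero => simpa using h
  | succ i ih =>
    rw [pow_succ p i, pow_mul, ← mul_geom_sum, ← add_assoc, pow_succ (p : ℤ) (j + i)]
    apply mul_dvd_mul ih
    have h1 : (p : ℤ) ∣ a ^ (p ^ i) - 1 := (dvd_pow_self _ (by omega)).trans ih
    simpa using dvd_geom_sum₂_self h1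

lemma unit_pow_one (m N : ℕ) [NeZero m] (u : (ZMod m)ˣ)
    (h : (m : ℤ) ∣ ((u : ZMod m).val : ℤ) ^ N - 1) : u ^ N = 1 := by
  apply Units.ext
  have := (ZMod.intCast_zmod_eq_zero_iff_dvd _ m).2 h
  push_cast at this
  rw [ZMod.natCast_zmod_val] at this
  push_cast
  exact sub_eq_zero.1 this

lemma exists_root_coprime {G : Type*} [Group G] (u : G) (N p : ℕ) (h : u ^ N = 1)
    (hc : Nat.Coprime p N) : ∃ v, v ^ p = u := by
  obtain ⟨m, hm⟩ := exists_pow_eq_self_of_coprime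
    (hc.coprime_dvd_right (orderOf_dvd_of_pow_eq_one h))
  exact ⟨u ^ m, by rw [← pow_mul, mul_comm, pow_mul, hm]⟩

lemma exists_root_cyc (p r : ℕ) (hp : p.Prime) (h2 : p ≠ 2) (u : (ZMod (p ^ (r + 2)))ˣ)
    (h : u ^ (p ^ r) = 1) : ∃ v, v ^ p = u := by
  have := ZMod.isCyclic_units_of_prime_pow p hp h2 (r + 2)
  have : NeZero (p ^ (r + 2)) := ⟨pow_ne_zero _ hp.ne_zero⟩
  obtain ⟨g, hg⟩ := IsCyclic.exists_generator (α := (ZMod (p ^ (r + 2)))ˣ)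
  have ho := orderOf_eq_card_of_forall_mem_zpowers hg
  rw [Nat.card_eq_fintype_card, ZMod.card_units_eq_totient, Nat.totient_prime_pow hp (by omega),
    show r + 2 - 1 = r + 1 by omega] at ho
  obtain ⟨j, rfl⟩ := Subgroup.mem_zpowers_iff.1 (hg u)
  rw [← zpow_natCast, ← zpow_mul] at h
  have h3 := orderOf_dvd_iff_zpow_eq_one.2 h
  have h4 : ((p ^ (r + 1) : ℕ) : ℤ) ∣ j * ((p ^ r : ℕ) : ℤ) := by
    refine dvd_trans ?_ h3
    rw [ho]
    push_cast
    exact Dvd.intro _ rfl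
  have hp0 : (p : ℤ) ^ r ≠ 0 := pow_ne_zero _ (by exact_mod_cast hp.ne_zero)
  push_cast at h4
  rw [pow_succ', mul_dvd_mul_iff_right hp0] at h4
  obtain ⟨i, rfl⟩ := h4
  exact ⟨g ^ i, by rw [← zpow_natCast, ← zpow_mul, mul_comm]⟩

lemma exists_sqrt (r : ℕ) (a : ℤ) (h : (8 : ℤ) ∣ a - 1) :
    ∃ x : ℤ, (2 : ℤ) ^ (r + 3) ∣ x ^ 2 - a := by
  suffices ∃ x : ℤ, (2 : ℤ) ^ (r + 3) ∣ x ^ 2 - a ∧ x % 2 = 1 by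
    obtain ⟨x, hx, -⟩ := this; exact ⟨x, hx⟩
  induction r with
  | zero => exact ⟨1, by rw [← dvd_neg]; simpa using h, by norm_num⟩
  | succ r ih =>
    obtain ⟨x, ⟨c, hc⟩, hx⟩ := ih
    obtain ⟨y, rfl⟩ : ∃ y, x = 2 * y + 1 := ⟨x / 2, by omega⟩
    rcases Int.even_or_odd' c with ⟨d, rfl | rfl⟩
    · exact ⟨2 * y + 1, ⟨d, by rw [hc]; ring⟩, hx⟩
    · refine ⟨2 * y + 1 + 2 ^ (r + 2), ⟨d + 1 + y + 2 ^ r, ?_⟩, ?_⟩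
      · linear_combination hc
      · rw [pow_succ]; omega

lemma exists_root_two (r : ℕ) (u : (ZMod (2 ^ (r + 3)))ˣ)
    (h : (8 : ℤ) ∣ ((u : ZMod (2 ^ (r + 3))).val : ℤ) - 1) : ∃ v, v ^ 2 = u := by
  obtain ⟨x, hx⟩ := exists_sqrt r _ h
  have := (ZMod.intCast_zmod_eq_zero_iff_dvd _ (2 ^ (r + 3))).2 (by exact_mod_cast hx)
  push_cast at this
  rw [ZMod.natCast_zmod_val] at this
  have h1 : (x : ZMod (2 ^ (r + 3))) * x = u := by linear_combination this
  have h2 : IsUnit (x : ZMod (2 ^ (r + 3))) := isUnit_of_mul_isUnit_left (h1 ▸ u.isUnit)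
  exact ⟨h2.unit, Units.ext (by rw [pow_two]; simpa using h1)⟩

lemma exists_conj (K : IntermediateField ℚ (AlgebraicClosure ℚ)) (hreal : IsTotallyReal ↥K) :
    ∃ c : AlgebraicClosure ℚ ≃ₐ[ℚ] AlgebraicClosure ℚ,
      (∀ n : ℕ, n ≠ 0 → ∀ ζ : AlgebraicClosure ℚ, ζ ^ n = 1 → c ζ = ζ⁻¹) ∧ ∀ x ∈ K, c x = x := by
  let φ : AlgebraicClosure ℚ →ₐ[ℚ] ℂ := IsAlgClosed.lift
  let _ : Algebra (AlgebraicClosure ℚ) ℂ := φ.toRingHom.toAlgebra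
  let c := AlgEquiv.restrictNormal (Complex.conjAe.restrictScalars ℚ) (AlgebraicClosure ℚ)
  have hc : ∀ x, φ (c x) = (starRingEnd ℂ) (φ x) := fun x =>
    AlgEquiv.restrictNormal_commutes (Complex.conjAe.restrictScalars ℚ) (AlgebraicClosure ℚ) x
  have hinj : Function.Injective φ := φ.toRingHom.injective
  refine ⟨c, ?_, ?_⟩
  · intro n hn ζ hζ
    apply hinj
    rw [hc, map_inv₀]
    have h1 : ‖φ ζ‖ = 1 := by
      apply Complex.norm_eq_one_of_pow_eq_one (n := n) _ hn
      rw [← map_pow, hζ, map_one]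
    rw [Complex.inv_def, Complex.normSq_eq_norm_sq, h1]
    simp
  · intro x hx
    apply hinj
    rw [hc]
    have := hreal (φ.toRingHom.comp (algebraMap K (AlgebraicClosure ℚ))) ⟨x, hx⟩
    exact Complex.conj_eq_iff_im.2 this

lemma restrict_eq_one_iff (K : IntermediateField ℚ (AlgebraicClosure ℚ)) [Normal ℚ ↥K]
    (τ : AlgebraicClosure ℚ ≃ₐ[ℚ] AlgebraicClosure ℚ) :
    AlgEquiv.restrictNormalHom (↥K) τ = 1 ↔ ∀ x ∈ K, τ x = x := by
  have h : ∀ x : K, ((AlgEquiv.restrictNormalHom (↥K) τ x : K) : AlgebraicClosure ℚ) = τ x :=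
    fun x => AlgEquiv.restrictNormal_commutes τ K x
  constructor
  · intro h1 x hx
    have := h ⟨x, hx⟩
    rw [h1] at this
    exact this.symm
  · intro h1
    ext x
    rw [h]
    exact h1 x x.2

lemma fix_of_root (p : ℕ) (K : IntermediateField ℚ (AlgebraicClosure ℚ))
    [FiniteDimensional ℚ ↥K] [IsGalois ℚ ↥K] (hdeg : finrank ℚ ↥K = p) (m : ℕ) (hm : 0 < m)
    (χ : (AlgebraicClosure ℚ ≃ₐ[ℚ] AlgebraicClosure ℚ) →* (ZMod m)ˣ)
    (hχ : Function.Surjective χ)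
    (hχs : ∀ g, ∀ ζ : AlgebraicClosure ℚ, ζ ^ m = 1 → g ζ = ζ ^ ((χ g : ZMod m).val))
    (hker : ∀ τ : AlgebraicClosure ℚ ≃ₐ[ℚ] AlgebraicClosure ℚ,
      (∀ ζ : AlgebraicClosure ℚ, ζ ^ m = 1 → τ ζ = ζ) → ∀ x ∈ K, τ x = x)
    (τ : AlgebraicClosure ℚ ≃ₐ[ℚ] AlgebraicClosure ℚ) (h : ∃ v, v ^ p = χ τ) :
    ∀ x ∈ K, τ x = x := by
  obtain ⟨v, hv⟩ := h
  obtain ⟨g, rfl⟩ := hχ v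
  have h1 : χ (τ * (g ^ p)⁻¹) = 1 := by
    rw [map_mul, map_inv, map_pow, hv, mul_inv_cancel]
  have h2 : ∀ ζ : AlgebraicClosure ℚ, ζ ^ m = 1 → (τ * (g ^ p)⁻¹) ζ = ζ := by
    intro ζ hζ
    rw [hχs _ ζ hζ, h1]
    rcases Nat.lt_or_ge 1 m with h | h
    · have := Fact.mk h
      simp [ZMod.val_one]
    · obtain rfl : m = 1 := by omega
      rw [pow_one] at hζ
      simp [hζ]
  have h3 := (restrict_eq_one_iff K _).2 (hker _ h2)
  rw [map_mul, map_inv, map_pow, ← hdeg, ← IsGalois.card_aut_eq_finrank, pow_card_eq_one', inv_one,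
    mul_one] at h3
  exact (restrict_eq_one_iff K _).1 h3

lemma fix_mono (m n : ℕ) (h : m ∣ n) (τ : AlgebraicClosure ℚ ≃ₐ[ℚ] AlgebraicClosure ℚ)
    (hf : ∀ ζ : AlgebraicClosure ℚ, ζ ^ n = 1 → τ ζ = ζ) :
    ∀ ζ : AlgebraicClosure ℚ, ζ ^ m = 1 → τ ζ = ζ := by
  obtain ⟨c, rfl⟩ := h
  intro ζ hζ
  exact hf ζ (by rw [pow_mul, hζ, one_pow])

lemma finrank_sqrt_two (s : AlgebraicClosure ℚ) (hs : s ^ 2 = 2) :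
    FiniteDimensional ℚ (IntermediateField.adjoin ℚ {x : AlgebraicClosure ℚ | x ^ 2 = 2}) ∧ 
    finrank ℚ (IntermediateField.adjoin ℚ {x : AlgebraicClosure ℚ | x ^ 2 = 2}) ≤ 2 := by
  have e : IntermediateField.adjoin ℚ {x : AlgebraicClosure ℚ | x ^ 2 = 2} =
      IntermediateField.adjoin ℚ {s} := by
    apply le_antisymm
    · rw [IntermediateField.adjoin_le_iff]
      intro x hx
      have hx : x ^ 2 = 2 := hx
      have h1 : s ∈ IntermediateField.adjoin ℚ {s} := IntermediateField.mem_adjoin_simple_self ℚ s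
      rcases sq_eq_sq_iff_eq_or_eq_neg.1 (hx.trans hs.symm) with rfl | rfl
      · exact h1
      · exact neg_mem h1
    · exact IntermediateField.adjoin.mono _ _ _ (by simpa using hs)
  rw [e]
  have hi : IsIntegral ℚ s := Algebra.IsIntegral.isIntegral s
  have h1 := IntermediateField.adjoin.finiteDimensional hi
  have h2 := IntermediateField.adjoin.finrank hi
  have h3 : (minpoly ℚ s).natDegree ≤ 2 := by
    have : (Polynomial.X ^ 2 - Polynomial.C (2 : ℚ)).natDegree = 2 := by compute_degree!
    rw [← this]
    apply Polynomial.natDegree_le_of_dvd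
    · apply minpoly.dvd
      simp [hs]
    · intro h; rw [h] at this; simp at this
  constructor
  · convert h1
  · rw [← h2] at h3
    convert h3

lemma closure_equiv (k M : Type*) [Field k] [Field M] [Algebra k M] [IsAlgClosure k M] :
    Nonempty (AlgebraicClosure k ≃ₐ[k] M) := ⟨IsAlgClosure.equiv k _ _⟩

lemma fix_of_fix_sqrt_two (K : IntermediateField ℚ (AlgebraicClosure ℚ)) (hreal : IsTotallyReal ↥K)
    (h8 : ∀ τ : AlgebraicClosure ℚ ≃ₐ[ℚ] AlgebraicClosure ℚ,
      (∀ ζ : AlgebraicClosure ℚ, ζ ^ 8 = 1 → τ ζ = ζ) → ∀ x ∈ K, τ x = x) :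
    ∃ s : AlgebraicClosure ℚ, s ^ 2 = 2 ∧ ∀ τ : AlgebraicClosure ℚ ≃ₐ[ℚ] AlgebraicClosure ℚ,
      τ s = s → ∀ x ∈ K, τ x = x := by
  obtain ⟨z, hz⟩ := HasEnoughRootsOfUnity.exists_primitiveRoot (AlgebraicClosure ℚ) 8
  have hz4 : z ^ 4 = -1 := by
    have h1 : (z ^ 4 - 1) * (z ^ 4 + 1) = 0 := by
      linear_combination hz.pow_eq_one
    rcases mul_eq_zero.1 h1 with h | h
    · exact absurd (sub_eq_zero.1 h) (hz.pow_ne_one_of_pos_of_lt (by norm_num) (by norm_num))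
    · exact eq_neg_of_add_eq_zero_left h
  have hs : (z - z ^ 3) ^ 2 = 2 := by linear_combination (-2 + z ^ 2) * hz4
  refine ⟨z - z ^ 3, hs, ?_⟩
  intro τ hτ
  obtain ⟨c, hc1, hc2⟩ := exists_conj K hreal
  obtain ⟨χ, -, hχ⟩ := exists_chi 8 (by norm_num)
  have hu : ∀ u : (ZMod 8)ˣ, (u : ZMod 8).val = 1 ∨ (u : ZMod 8).val = 3 ∨ (u : ZMod 8).val = 5 ∨
    (u : ZMod 8).val = 7 := by decide
  have hs0 : z - z ^ 3 ≠ 0 := by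
    intro h; rw [h] at hs; norm_num at hs
  have hbad : ¬ (τ (z - z ^ 3) = -(z - z ^ 3)) := by
    rw [hτ]
    intro h
    exact hs0 (self_eq_neg.1 h)
  have hτz := hχ τ
  have e : τ (z - z ^ 3) = τ z - (τ z) ^ 3 := by simp
  rw [e, hτz z hz.pow_eq_one] at hbad
  rcases hu (χ τ) with h | h | h | h
  · apply h8
    intro ζ hζ
    rw [hτz ζ hζ, h, pow_one]
  · exfalso
    apply hbad
    rw [h]
    linear_combination (z - z ^ 5) * hz4
  · exfalso
    apply hbad
    rw [h]
    linear_combination (z - z ^ 11 + z ^ 7 - z ^ 3) * hz4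
  · have h9 : ∀ x ∈ K, (c * τ) x = x := by
      apply h8
      intro ζ hζ
      have h0 : ζ ≠ 0 := by rintro rfl; simp at hζ
      rw [AlgEquiv.mul_apply, hτz ζ hζ, h, map_pow, hc1 8 (by norm_num) ζ hζ]
      field_simp
      exact hζ.symm
    intro x hx
    have h10 := h9 x hx
    rw [AlgEquiv.mul_apply] at h10
    exact c.injective (h10.trans (hc2 x hx).symm)

lemma not_ker (p : ℕ) (hp : p.Prime)
    (K : IntermediateField ℚ (AlgebraicClosure ℚ))
    [FiniteDimensional ℚ ↥K] [IsGalois ℚ ↥K]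
    (hdeg : finrank ℚ ↥K = p)
    (hreal : IsTotallyReal ↥K)
    (hne2 : K ≠ IntermediateField.adjoin ℚ {x : AlgebraicClosure ℚ | x ^ 2 = 2})
    (hnotpsq : ¬ K ≤ cycField (p ^ 2))
    (hnotq : ∀ q : ℕ, q.Prime → q ≠ 2 → ¬ K ≤ cycField q) (l n : ℕ) (hl : l.Prime)
    (hker0 : ∀ τ : AlgebraicClosure ℚ ≃ₐ[ℚ] AlgebraicClosure ℚ,
      (∀ ζ : AlgebraicClosure ℚ, ζ ^ (l ^ n) = 1 → τ ζ = ζ) → ∀ x ∈ K, τ x = x) : False := by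
  have hker : ∀ τ : AlgebraicClosure ℚ ≃ₐ[ℚ] AlgebraicClosure ℚ,
      (∀ ζ : AlgebraicClosure ℚ, ζ ^ (l ^ (n + 3)) = 1 → τ ζ = ζ) → ∀ x ∈ K, τ x = x :=
    fun τ h => hker0 τ (fix_mono _ _ (pow_dvd_pow _ (by omega)) τ h)
  have hm : 0 < l ^ (n + 3) := pow_pos hl.pos _
  have : NeZero (l ^ (n + 3)) := ⟨hm.ne'⟩
  obtain ⟨χ, hχ, hχs⟩ := exists_chi (l ^ (n + 3)) hm
  have key := fix_of_root p K hdeg _ hm χ hχ hχs hker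
  by_cases hpl : p = l
  · subst hpl
    by_cases h2 : p = 2
    · subst h2
      have h8 : ∀ τ : AlgebraicClosure ℚ ≃ₐ[ℚ] AlgebraicClosure ℚ,
          (∀ ζ : AlgebraicClosure ℚ, ζ ^ 8 = 1 → τ ζ = ζ) → ∀ x ∈ K, τ x = x := by
        intro τ hτ
        apply key
        apply exists_root_two
        exact chi_modEq _ 8 hm ⟨2 ^ n, by ring⟩ τ _ (hχs τ) hτ
      obtain ⟨s, hs, hs2⟩ := fix_of_fix_sqrt_two K hreal h8
      have hle := le_adjoin_of_fix K {x : AlgebraicClosure ℚ | x ^ 2 = 2}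
        (fun τ hτ => hs2 τ (hτ s hs))
      obtain ⟨hf, hr⟩ := finrank_sqrt_two s hs
      apply hne2
      refine @IntermediateField.eq_of_le_of_finrank_le _ _ _ _ _ _ _ ?_ hle ?_
      · convert hf
      · have hr' := hr.trans hdeg.ge
        convert hr'
    · apply hnotpsq
      apply le_adjoin_of_fix
      intro τ hτ
      apply key
      apply exists_root_cyc p (n + 1) hp h2
      apply unit_pow_one
      have := chi_modEq _ (p ^ 2) hm (pow_dvd_pow _ (by omega)) τ _ (hχs τ) hτ
      rw [Nat.cast_pow] at this
      have := pow_step p 2 (by norm_num) (n + 1) _ this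
      rw [show 2 + (n + 1) = n + 3 by omega] at this
      rw [Nat.cast_pow]
      exact this
  · have hfl : ∀ τ : AlgebraicClosure ℚ ≃ₐ[ℚ] AlgebraicClosure ℚ,
          (∀ ζ : AlgebraicClosure ℚ, ζ ^ l = 1 → τ ζ = ζ) → ∀ x ∈ K, τ x = x := by
      intro τ hτ
      apply key
      apply exists_root_coprime _ (l ^ (n + 2)) p _
        (Nat.Coprime.pow_right _ ((Nat.coprime_primes hp hl).2 hpl))
      apply unit_pow_one
      have := chi_modEq _ l hm (dvd_pow_self _ (by omega)) τ _ (hχs τ) hτ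
      rw [← pow_one (l : ℤ)] at this
      have := pow_step l 1 (by norm_num) (n + 2) _ this
      rw [show 1 + (n + 2) = n + 3 by omega] at this
      rw [Nat.cast_pow]
      exact this
    by_cases h2 : l = 2
    · subst h2
      apply hnotq 3 (by norm_num) (by norm_num)
      apply le_adjoin_of_fix
      intro τ _
      apply hfl
      intro ζ hζ
      rcases (sq_eq_sq_iff_eq_or_eq_neg.1 (hζ.trans (one_pow 2).symm)) with rfl | rfl <;> simp
    · exact hnotq l hl h2 (le_adjoin_of_fix _ _ hfl)

lemma chi_surj (p : ℕ) (hp : p.Prime) (K : IntermediateField ℚ (AlgebraicClosure ℚ))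
    [FiniteDimensional ℚ ↥K] [IsGalois ℚ ↥K] (hdeg : finrank ℚ ↥K = p) (m : ℕ)
    (χ : (AlgebraicClosure ℚ ≃ₐ[ℚ] AlgebraicClosure ℚ) →* (ZMod m)ˣ)
    (hχ : Function.Surjective χ) (hm : 0 < m)
    (hχs : ∀ g, ∀ ζ : AlgebraicClosure ℚ, ζ ^ m = 1 → g ζ = ζ ^ ((χ g : ZMod m).val))
    (hker : ¬ ∀ τ : AlgebraicClosure ℚ ≃ₐ[ℚ] AlgebraicClosure ℚ,
      (∀ ζ : AlgebraicClosure ℚ, ζ ^ m = 1 → τ ζ = ζ) → ∀ x ∈ K, τ x = x)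
    (u : (ZMod m)ˣ) : ∃ g, χ g = u ∧ ∀ x ∈ K, g x = x := by
  push Not at hker
  obtain ⟨τ, h1, y, hy, hyK⟩ := hker
  have : NeZero m := ⟨hm.ne'⟩
  have h2 : χ τ = 1 := by
    have := chi_modEq m m hm dvd_rfl τ _ (hχs τ) h1
    have := unit_pow_one m 1 (χ τ) (by simpa using this)
    simpa using this
  obtain ⟨g, rfl⟩ := hχ u
  have := Fact.mk hp
  have h3 : AlgEquiv.restrictNormalHom (↥K) τ ≠ 1 := fun h =>
    hyK ((restrict_eq_one_iff K τ).1 h y hy)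
  have hcard : Nat.card (K ≃ₐ[ℚ] K) = p := by rw [IsGalois.card_aut_eq_finrank, hdeg]
  obtain ⟨j, hj⟩ := Subgroup.mem_zpowers_iff.1
    (mem_zpowers_of_prime_card hcard (g' := AlgEquiv.restrictNormalHom (↥K) g) h3)
  refine ⟨g * (τ ^ j)⁻¹, by simp [h2], ?_⟩
  rw [← restrict_eq_one_iff, map_mul, map_inv, map_zpow, hj, mul_inv_cancel]

lemma mem_wSet_iff_s11 (p : ℕ) (hp : p.Prime)
    (K : IntermediateField ℚ (AlgebraicClosure ℚ))
    [FiniteDimensional ℚ ↥K] [IsGalois ℚ ↥K]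
    (hdeg : finrank ℚ ↥K = p)
    (hreal : IsTotallyReal ↥K)
    (hne2 : K ≠ IntermediateField.adjoin ℚ {x : AlgebraicClosure ℚ | x ^ 2 = 2})
    (hnotpsq : ¬ K ≤ cycField (p ^ 2))
    (hnotq : ∀ q : ℕ, q.Prime → q ≠ 2 → ¬ K ≤ cycField q) (j m : ℕ) :
    m ∈ wSet ↥K j ↔ 0 < m ∧ ArithmeticFunction.carmichael m ∣ j := by
  have : IsAlgClosure K (AlgebraicClosure ℚ) := ⟨inferInstance, inferInstance⟩
  obtain ⟨e⟩ := closure_equiv K (AlgebraicClosure ℚ)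
  unfold wSet
  rw [Set.mem_ofPred_eq]
  refine and_congr_right fun hm => ?_
  have : NeZero m := ⟨hm.ne'⟩
  have step : (∀ σ : AlgebraicClosure K ≃ₐ[K] AlgebraicClosure K,
      ∀ ζ : AlgebraicClosure K, ζ ^ m = 1 → (σ ^ j) ζ = ζ) ↔
      ∀ g : AlgebraicClosure ℚ ≃ₐ[ℚ] AlgebraicClosure ℚ, (∀ x ∈ K, g x = x) →
        ∀ ζ : AlgebraicClosure ℚ, ζ ^ m = 1 → (g ^ j) ζ = ζ := by
    constructor
    · intro h g hg ζ hζ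
      let g' : AlgebraicClosure ℚ ≃ₐ[K] AlgebraicClosure ℚ :=
        AlgEquiv.ofRingEquiv (f := g.toRingEquiv) (fun x => hg x x.2)
      let σ : AlgebraicClosure K ≃ₐ[K] AlgebraicClosure K := (e.trans g').trans e.symm
      have hσ : ∀ i : ℕ, ∀ x, e ((σ ^ i) x) = (g ^ i) (e x) := by
        intro i
        induction i with
        | zero => intro x; simp
        | succ i ih =>
          intro x
          rw [pow_succ, pow_succ, AlgEquiv.mul_apply, AlgEquiv.mul_apply, ih]
          congr 1
          exact e.apply_symm_apply _
      have := h σ (e.symm ζ) (by rw [← map_pow, hζ, map_one])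
      have h2 := hσ j (e.symm ζ)
      rw [this, e.apply_symm_apply] at h2
      exact h2.symm
    · intro h σ ζ hζ
      let g' : AlgebraicClosure ℚ ≃ₐ[K] AlgebraicClosure ℚ := (e.symm.trans σ).trans e
      let g : AlgebraicClosure ℚ ≃ₐ[ℚ] AlgebraicClosure ℚ := g'.restrictScalars ℚ
      have hσ : ∀ i : ℕ, ∀ x, e ((σ ^ i) x) = (g ^ i) (e x) := by
        intro i
        induction i with
        | zero => intro x; simp
        | succ i ih =>
          intro x
          rw [pow_succ, pow_succ, AlgEquiv.mul_apply, AlgEquiv.mul_apply, ih]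
          congr 1
          change _ = e (σ (e.symm (e x)))
          rw [e.symm_apply_apply]
      have := h g (fun x hx => g'.commutes ⟨x, hx⟩) (e ζ) (by rw [← map_pow, hζ, map_one])
      rw [← hσ] at this
      exact e.injective this
  rw [step]
  constructor
  · intro h
    rw [ArithmeticFunction.carmichael_factorization]
    apply Finset.lcm_dvd
    intro l hl
    have hlp := Nat.prime_of_mem_primeFactors hl
    set M := l ^ m.factorization l with hM
    have hMpos : 0 < M := pow_pos hlp.pos _
    have : NeZero M := ⟨hMpos.ne'⟩
    have hMd : M ∣ m := Nat.ordProj_dvd m l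
    rw [ArithmeticFunction.carmichael_eq_exponent' M]
    apply Monoid.exponent_dvd_of_forall_pow_eq_one
    intro u
    obtain ⟨χ, hχ, hχs⟩ := exists_chi M hMpos
    obtain ⟨g, rfl, hg⟩ := chi_surj p hp K hdeg M χ hχ hMpos hχs
      (not_ker p hp K hdeg hreal hne2 hnotpsq hnotq l _ hlp) u
    rw [← map_pow]
    have h3 := fix_mono M m hMd _ (h g hg)
    have := chi_modEq M M hMpos dvd_rfl (g ^ j) _ (hχs _) h3
    have := unit_pow_one M 1 (χ (g ^ j)) (by simpa using this)
    simpa using this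
  · rintro ⟨c, rfl⟩ g hg ζ hζ
    obtain ⟨χ, hχ, hχs⟩ := exists_chi m hm
    have h1 : χ (g ^ (ArithmeticFunction.carmichael m * c)) = χ 1 := by
      rw [map_pow, pow_mul, ArithmeticFunction.pow_carmichael, one_pow, map_one]
    rw [hχs _ ζ hζ, h1, ← hχs _ ζ hζ]
    rfl

theorem w_of_generic_totallyReal_cyclic_degree_p
    (p : ℕ) (hp : p.Prime)
    (K : IntermediateField ℚ (AlgebraicClosure ℚ))
    [FiniteDimensional ℚ ↥K] [IsGalois ℚ ↥K]
    (hcyc : IsCyclic (↥K ≃ₐ[ℚ] ↥K))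
    (hdeg : finrank ℚ ↥K = p)
    (hreal : IsTotallyReal ↥K)
    (hne2 : K ≠ IntermediateField.adjoin ℚ {x : AlgebraicClosure ℚ | x ^ 2 = 2})
    (hnotpsq : ¬ K ≤ cycField (p ^ 2))
    (hnotq : ∀ q : ℕ, q.Prime → q ≠ 2 → ¬ K ≤ cycField q)
    (k : ℕ) (hk : 1 ≤ k) :
    (w ↥K (2 * k) = ∏ᶠ (ℓ : ℕ) (_ : ℓ.Prime ∧ (ℓ - 1) ∣ 2 * k),
        ℓ ^ (1 + padicValNat ℓ (4 * k))) ∧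
    (w ↥K (2 * k) = 2 ^ (3 + padicValNat 2 k) *
        ∏ᶠ (ℓ : ℕ) (_ : ℓ.Prime ∧ ℓ ≠ 2 ∧ (ℓ - 1) ∣ 2 * k),
          ℓ ^ (1 + padicValNat ℓ k)) := by
  exact arith_final k hk _
    (fun m => mem_wSet_iff_s11 p hp K hdeg hreal hne2 hnotpsq hnotq (2 * k) m)
end
end
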